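/- arXiv:1311.5966 — 3 statements merged into one kernel-verified Lean document; each statement's English description precedes it below -/
import Mathlib

section
/- (Menu Monotonicity) Assume Condition 1. Then there exists an optimal feasible utility function u with the following property: for any two points z, z' ∈ V at which u is differentiable, writing q(z) = (∂₁u(z), ∂₂u(z)) and payment t(z) = ∂₁u(z)·z₁ + ∂₂u(z)·z₂ − u(z), if t(z) < t(z') then ∂₁u(z) ≤ ∂₁u(z') and ∂₂u(z) ≤ ∂₂u(z'), and if t(z) = t(z') then q(z) = q(z'). -/
open MeasureTheory Set

noncomputable section

/-- A positive, bounded, differentiable density on `[a,b]` integrating to 1. -/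
def Density (a b : ℝ) (h : ℝ → ℝ) : Prop :=
  (∀ x ∈ Set.Icc a b, 0 < h x) ∧ (∃ M, ∀ x ∈ Set.Icc a b, h x ≤ M) ∧
  (∀ x ∈ Set.Icc a b, DifferentiableAt ℝ h x) ∧ (∫ x in a..b, h x) = 1

/-- The valuation rectangle `V = [xA,xB] × [yA,yC]`. -/
def V (xA xB yA yC : ℝ) : Set (ℝ × ℝ) := Set.Icc (xA, yA) (xB, yC)

/-- First partial derivative. -/
def pd1 (u : ℝ × ℝ → ℝ) (z : ℝ × ℝ) : ℝ := fderiv ℝ u z (1, 0)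

/-- Second partial derivative. -/
def pd2 (u : ℝ × ℝ → ℝ) (z : ℝ × ℝ) : ℝ := fderiv ℝ u z (0, 1)

/-- A feasible buyer utility function: nonnegative, convex, with increments in each
coordinate between `0` and the coordinate increment (partial derivatives in `[0,1]`). -/
def Feasible (xA xB yA yC : ℝ) (u : ℝ × ℝ → ℝ) : Prop :=
  (∀ z ∈ V xA xB yA yC, 0 ≤ u z) ∧
  ConvexOn ℝ (V xA xB yA yC) u ∧
  (∀ x x' y, xA ≤ x → x ≤ x' → x' ≤ xB → y ∈ Set.Icc yA yC →
    0 ≤ u (x', y) - u (x, y) ∧ u (x', y) - u (x, y) ≤ x' - x) ∧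
  (∀ x y y', x ∈ Set.Icc xA xB → yA ≤ y → y ≤ y' → y' ≤ yC →
    0 ≤ u (x, y') - u (x, y) ∧ u (x, y') - u (x, y) ≤ y' - y)

/-- The seller's expected revenue from utility function `u` under joint density
`f₁(x)·f₂(y)`. -/
def Rev (xA xB yA yC : ℝ) (f1 f2 : ℝ → ℝ) (u : ℝ × ℝ → ℝ) : ℝ :=
  ∫ z in V xA xB yA yC, (z.1 * pd1 u z + z.2 * pd2 u z - u z) * (f1 z.1 * f2 z.2)

/-- The optimal revenue: supremum of revenue over feasible utility functions. -/
def OptRev (xA xB yA yC : ℝ) (f1 f2 : ℝ → ℝ) : ℝ :=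
  sSup {r | ∃ u, Feasible xA xB yA yC u ∧ r = Rev xA xB yA yC f1 f2 u}

/-- A feasible utility function is optimal if its revenue attains the supremum. -/
def Optimal (xA xB yA yC : ℝ) (f1 f2 : ℝ → ℝ) (u : ℝ × ℝ → ℝ) : Prop :=
  Feasible xA xB yA yC u ∧ Rev xA xB yA yC f1 f2 u = OptRev xA xB yA yC f1 f2

/-- The power rate of a density `h`: `PR(h)(x) = x·h'(x)/h(x)`. -/
def PR (h : ℝ → ℝ) (x : ℝ) : ℝ := x * deriv h x / h x

/-- The bundling revenue `BRev = sup_{p ≥ 0} p · ∫_{x+y ≥ p} f`. -/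
def BRev (xA xB yA yC : ℝ) (f1 f2 : ℝ → ℝ) : ℝ :=
  sSup {r | ∃ p, 0 ≤ p ∧
    r = p * ∫ z in {z ∈ V xA xB yA yC | p ≤ z.1 + z.2}, f1 z.1 * f2 z.2}

/-- The payment associated with utility `u` at a point of differentiability. -/
def pay (u : ℝ × ℝ → ℝ) (z : ℝ × ℝ) : ℝ := pd1 u z * z.1 + pd2 u z * z.2 - u z

/-- The derivative of `x ↦ x * f x`. -/
def idMulDeriv (f : ℝ → ℝ) (x : ℝ) : ℝ := f x + x * deriv f x

/-- The interior of the valuation rectangle. -/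
def openV (xA xB yA yC : ℝ) : Set (ℝ × ℝ) := Ioo xA xB ×ˢ Ioo yA yC

section Rectangle

variable {xA xB yA yC : ℝ} {u v : ℝ × ℝ → ℝ} {z w : ℝ × ℝ}

theorem mem_V : z ∈ V xA xB yA yC ↔ z.1 ∈ Icc xA xB ∧ z.2 ∈ Icc yA yC := by
  simp only [V, mem_Icc, Prod.le_def]
  tauto

theorem V_eq_prod : V xA xB yA yC = Icc xA xB ×ˢ Icc yA yC := by
  rw [Icc_prod_Icc]
  rfl

theorem measurableSet_V : MeasurableSet (V xA xB yA yC) := measurableSet_Icc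

theorem isCompact_V : IsCompact (V xA xB yA yC) := isCompact_Icc

theorem convex_V : Convex ℝ (V xA xB yA yC) := convex_Icc _ _

theorem interior_V : interior (V xA xB yA yC) = openV xA xB yA yC := by
  rw [V_eq_prod, interior_prod_eq, interior_Icc, interior_Icc, openV]

theorem isOpen_openV : IsOpen (openV xA xB yA yC) := isOpen_Ioo.prod isOpen_Ioo

theorem openV_subset_V : openV xA xB yA yC ⊆ V xA xB yA yC :=
  interior_V.symm.subset.trans interior_subset

theorem V_mem_nhds (hz : z ∈ openV xA xB yA yC) : V xA xB yA yC ∈ nhds z :=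
  Filter.mem_of_superset (isOpen_openV.mem_nhds hz) openV_subset_V

theorem openV_ae_eq_V : openV xA xB yA yC =ᵐ[volume] V xA xB yA yC := by
  rw [V_eq_prod]
  exact Measure.set_prod_ae_eq Ioo_ae_eq_Icc Ioo_ae_eq_Icc

theorem volume_restrict_V :
    (volume : Measure (ℝ × ℝ)).restrict (V xA xB yA yC) =
      (volume.restrict (Icc xA xB)).prod (volume.restrict (Icc yA yC)) := by
  rw [V_eq_prod, Measure.prod_restrict, Measure.volume_eq_prod]

theorem ae_mem_openV : ∀ᵐ z ∂volume.restrict (V xA xB yA yC), z ∈ openV xA xB yA yC := by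
  rw [← Measure.restrict_congr_set openV_ae_eq_V]
  exact ae_restrict_mem isOpen_openV.measurableSet

theorem swap_preimage_V : Prod.swap ⁻¹' V xA xB yA yC = V yA yC xA xB := by
  ext z
  simp only [mem_preimage, mem_V, Prod.fst_swap, Prod.snd_swap]
  tauto

namespace Feasible

theorem congr (h : Feasible xA xB yA yC u) (huv : EqOn u v (V xA xB yA yC)) :
    Feasible xA xB yA yC v := by
  obtain ⟨hn, hc, hx, hy⟩ := h
  refine ⟨fun z hz => huv hz ▸ hn z hz, hc.congr huv, fun x x' y h1 h2 h3 hy' => ?_,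
    fun x y y' hx' h1 h2 h3 => ?_⟩
  · rw [← huv (mem_V.2 ⟨⟨h1.trans h2, h3⟩, hy'⟩), ← huv (mem_V.2 ⟨⟨h1, h2.trans h3⟩, hy'⟩)]
    exact hx x x' y h1 h2 h3 hy'
  · rw [← huv (mem_V.2 ⟨hx', ⟨h1.trans h2, h3⟩⟩), ← huv (mem_V.2 ⟨hx', ⟨h1, h2.trans h3⟩⟩)]
    exact hy x y y' hx' h1 h2 h3

theorem swap (h : Feasible xA xB yA yC u) : Feasible yA yC xA xB (u ∘ Prod.swap) := by
  obtain ⟨hn, hc, hx, hy⟩ := h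
  refine ⟨fun z hz => hn z.swap ?_, ?_, fun x x' y h1 h2 h3 hy' => hy y x x' hy' h1 h2 h3,
    fun x y y' hx' h1 h2 h3 => hx y y' x h1 h2 h3 hx'⟩
  · rwa [← swap_preimage_V] at hz
  · rw [← swap_preimage_V]
    exact hc.comp_linearMap (LinearEquiv.prodComm ℝ ℝ ℝ).toLinearMap

theorem abs_sub_le_fst (h : Feasible xA xB yA yC u) {x x' y : ℝ} (hx : x ∈ Icc xA xB)
    (hx' : x' ∈ Icc xA xB) (hy : y ∈ Icc yA yC) : |u (x, y) - u (x', y)| ≤ |x - x'| := by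
  rcases le_total x x' with hle | hle
  · have := h.2.2.1 x x' y hx.1 hle hx'.2 hy
    rw [abs_sub_comm, abs_sub_comm x, abs_of_nonneg this.1, abs_of_nonneg (sub_nonneg.2 hle)]
    exact this.2
  · have := h.2.2.1 x' x y hx'.1 hle hx.2 hy
    rw [abs_of_nonneg this.1, abs_of_nonneg (sub_nonneg.2 hle)]
    exact this.2

theorem abs_sub_le (h : Feasible xA xB yA yC u) (hz : z ∈ V xA xB yA yC)
    (hw : w ∈ V xA xB yA yC) : |u z - u w| ≤ |z.1 - w.1| + |z.2 - w.2| := by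
  rw [mem_V] at hz hw
  have e1 := h.abs_sub_le_fst hz.1 hw.1 hz.2
  have e2 : |u (w.1, z.2) - u (w.1, w.2)| ≤ |z.2 - w.2| := h.swap.abs_sub_le_fst hz.2 hw.2 hw.1
  have := _root_.abs_sub_le (u (z.1, z.2)) (u (w.1, z.2)) (u (w.1, w.2))
  linarith

theorem lipschitzOnWith (h : Feasible xA xB yA yC u) : LipschitzOnWith 2 u (V xA xB yA yC) := by
  refine LipschitzOnWith.of_dist_le_mul fun z hz w hw => ?_
  have := h.abs_sub_le hz hw
  have e1 : |z.1 - w.1| ≤ dist z w := le_max_left (dist z.1 w.1) (dist z.2 w.2)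
  have e2 : |z.2 - w.2| ≤ dist z w := le_max_right (dist z.1 w.1) (dist z.2 w.2)
  rw [Real.dist_eq, NNReal.coe_ofNat]
  linarith

theorem continuousOn (h : Feasible xA xB yA yC u) : ContinuousOn u (V xA xB yA yC) :=
  h.lipschitzOnWith.continuousOn

theorem mono_fst (h : Feasible xA xB yA yC u) {x x' y : ℝ} (h1 : xA ≤ x) (h2 : x ≤ x')
    (h3 : x' ≤ xB) (hy : y ∈ Icc yA yC) : u (x, y) ≤ u (x', y) :=
  sub_nonneg.1 (h.2.2.1 x x' y h1 h2 h3 hy).1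

theorem bounds (h : Feasible xA xB yA yC u) (hz : z ∈ V xA xB yA yC) :
    0 ≤ u z ∧ u z ≤ u (xA, yA) + (xB - xA) + (yC - yA) := by
  refine ⟨h.1 z hz, ?_⟩
  have hz' := mem_V.1 hz
  have hA : (xA, yA) ∈ V xA xB yA yC :=
    mem_V.2 ⟨⟨le_rfl, hz'.1.1.trans hz'.1.2⟩, ⟨le_rfl, hz'.2.1.trans hz'.2.2⟩⟩
  have := (le_abs_self _).trans (h.abs_sub_le hz hA)
  rw [abs_of_nonneg (sub_nonneg.2 hz'.1.1), abs_of_nonneg (sub_nonneg.2 hz'.2.1)] at this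
  linarith [hz'.1.2, hz'.2.2]

theorem ae_differentiableAt (h : Feasible xA xB yA yC u) :
    ∀ᵐ z ∂volume.restrict (V xA xB yA yC), z ∈ openV xA xB yA yC ∧ DifferentiableAt ℝ u z := by
  filter_upwards [h.lipschitzOnWith.ae_differentiableWithinAt measurableSet_V, ae_mem_openV]
    with z hz hzo
  exact ⟨hzo, hz.differentiableAt (V_mem_nhds hzo)⟩

theorem add_fderiv_le (h : Feasible xA xB yA yC u) (hz : z ∈ V xA xB yA yC)
    (hd : DifferentiableAt ℝ u z) (hw : w ∈ V xA xB yA yC) :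
    u z + pd1 u z * (w.1 - z.1) + pd2 u z * (w.2 - z.2) ≤ u w := by
  have hl := hd.hasFDerivAt.hasLineDerivAt (w - z)
  have hg : ConvexOn ℝ (Icc 0 1) (fun t : ℝ => u (z + t • (w - z))) := by
    have := h.2.1.comp_affineMap (AffineMap.lineMap (k := ℝ) z w)
    refine (this.subset ?_ (convex_Icc 0 1)).congr ?_
    · intro t ht
      exact convex_V.lineMap_mem hz hw ht
    · intro t _
      simp [AffineMap.lineMap_apply, add_comm]
  have := hg.le_slope_of_hasDerivAt (left_mem_Icc.2 zero_le_one) (right_mem_Icc.2 zero_le_one)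
    zero_lt_one hl
  have e : fderiv ℝ u z (w - z) = pd1 u z * (w.1 - z.1) + pd2 u z * (w.2 - z.2) := by
    have : w - z = (w.1 - z.1) • ((1, 0) : ℝ × ℝ) + (w.2 - z.2) • ((0, 1) : ℝ × ℝ) := by
      ext <;> simp
    rw [this, map_add, map_smul, map_smul, pd1, pd2, smul_eq_mul, smul_eq_mul]
    ring
  simp only [slope_def_field, e, one_smul, zero_smul, add_sub_cancel, add_zero, sub_zero,
    div_one] at this
  linarith

theorem pd1_mem_Icc (h : Feasible xA xB yA yC u) (hz : z ∈ openV xA xB yA yC)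
    (hd : DifferentiableAt ℝ u z) : pd1 u z ∈ Icc (0 : ℝ) 1 := by
  obtain ⟨⟨hx1, hx2⟩, hy1, hy2⟩ := id hz
  have hy : z.2 ∈ Icc yA yC := ⟨hy1.le, hy2.le⟩
  have hzV := openV_subset_V hz
  constructor
  · have e1 := h.add_fderiv_le hzV hd (w := (xA, z.2))
      (mem_V.2 ⟨⟨le_rfl, (hx1.trans hx2).le⟩, hy⟩)
    have e2 : u (xA, z.2) ≤ u z := h.mono_fst le_rfl hx1.le hx2.le hy
    simp only [sub_self, mul_zero, add_zero] at e1
    by_contra! hneg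
    nlinarith
  · have e1 := h.add_fderiv_le hzV hd (w := (xB, z.2))
      (mem_V.2 ⟨⟨(hx1.trans hx2).le, le_rfl⟩, hy⟩)
    have e2 : u (xB, z.2) - u z ≤ xB - z.1 :=
      (h.2.2.1 z.1 xB z.2 hx1.le hx2.le le_rfl hy).2
    simp only [sub_self, mul_zero, add_zero] at e1
    by_contra! hneg
    nlinarith

end Feasible

theorem pd1_comp_swap (u : ℝ × ℝ → ℝ) (z : ℝ × ℝ) : pd1 (u ∘ Prod.swap) z = pd2 u z.swap := by
  have := (ContinuousLinearEquiv.prodComm ℝ ℝ ℝ).comp_right_fderiv (f := u) (x := z)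
  exact congrArg (fun L => L (1, 0)) this

theorem pd2_comp_swap (u : ℝ × ℝ → ℝ) (z : ℝ × ℝ) : pd2 (u ∘ Prod.swap) z = pd1 u z.swap := by
  have := (ContinuousLinearEquiv.prodComm ℝ ℝ ℝ).comp_right_fderiv (f := u) (x := z)
  exact congrArg (fun L => L (0, 1)) this

theorem Feasible.pd2_mem_Icc (h : Feasible xA xB yA yC u) (hz : z ∈ openV xA xB yA yC)
    (hd : DifferentiableAt ℝ u z) : pd2 u z ∈ Icc (0 : ℝ) 1 := by
  have := h.swap.pd1_mem_Icc (z := z.swap) ⟨hz.2, hz.1⟩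
    ((show DifferentiableAt ℝ u (ContinuousLinearEquiv.prodComm ℝ ℝ ℝ z.swap) from hd).comp _
      (ContinuousLinearEquiv.prodComm ℝ ℝ ℝ).differentiableAt)
  rwa [pd1_comp_swap, Prod.swap_swap] at this

end Rectangle

section Density

variable {a b : ℝ} {f s : ℝ → ℝ}

theorem Density.continuousOn (hf : Density a b f) : ContinuousOn f (Icc a b) :=
  fun x hx => (hf.2.2.1 x hx).continuousAt.continuousWithinAt

theorem Density.integrableOn (hf : Density a b f) : IntegrableOn f (Icc a b) :=
  hf.continuousOn.integrableOn_Icc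

theorem Density.hasDerivAt_id_mul (hf : Density a b f) {x : ℝ} (hx : x ∈ Icc a b) :
    HasDerivAt (fun x => x * f x) (idMulDeriv f x) x := by
  have := (hasDerivAt_id x).mul (hf.2.2.1 x hx).hasDerivAt
  rwa [one_mul] at this

theorem Density.idMulDeriv_eq (hf : Density a b f) {x : ℝ} (hx : x ∈ Icc a b) :
    idMulDeriv f x = f x * (1 + PR f x) := by
  have := (hf.1 x hx).ne'
  rw [idMulDeriv, PR]
  field_simp

/-- An upper bound on the power rate makes the derivative of `x ↦ x * f x` integrable. -/
theorem Density.integrableOn_idMulDeriv (hf : Density a b f) {C : ℝ}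
    (hC : ∀ x ∈ Icc a b, PR f x ≤ C) : IntegrableOn (idMulDeriv f) (Icc a b) := by
  obtain ⟨M, hM⟩ := hf.2.1
  set K := M * max (1 + C) 0
  have hK : ∀ x ∈ Icc a b, idMulDeriv f x ≤ K := fun x hx => by
    rw [hf.idMulDeriv_eq hx]
    calc f x * (1 + PR f x) ≤ f x * max (1 + C) 0 :=
          mul_le_mul_of_nonneg_left (le_max_of_le_left (by linarith [hC x hx])) (hf.1 x hx).le
      _ ≤ K := mul_le_mul_of_nonneg_right (hM x hx) (le_max_right _ _)
  have h : IntegrableOn (fun x => K - idMulDeriv f x) (Ioc a b) := by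
    refine intervalIntegral.integrableOn_deriv_of_nonneg (g := fun x => K * x - x * f x) ?_ ?_ ?_
    · exact (continuousOn_const.mul continuousOn_id).sub (continuousOn_id.mul hf.continuousOn)
    · intro x hx
      have := ((hasDerivAt_id x).const_mul K).sub (hf.hasDerivAt_id_mul (Ioo_subset_Icc_self hx))
      rwa [mul_one] at this
    · exact fun x hx => sub_nonneg.2 (hK x (Ioo_subset_Icc_self hx))
  rw [← integrableOn_Icc_iff_integrableOn_Ioc] at h
  have h' : IntegrableOn (fun _ => K) (Icc a b) := continuousOn_const.integrableOn_Icc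
  refine (h'.sub h).congr (Filter.Eventually.of_forall fun x => ?_)
  simp

theorem Density.integral_mul_rightDeriv (hf : Density a b f) (hab : a < b)
    (hint : IntegrableOn (idMulDeriv f) (Icc a b)) (hs : ConvexOn ℝ (Icc a b) s)
    (hsc : ContinuousOn s (Icc a b)) (hm : MonotoneOn s (Icc a b)) :
    ∫ y in Icc a b, y * f y * derivWithin s (Ioi y) y =
      b * f b * s b - a * f a * s a - ∫ y in Icc a b, idMulDeriv f y * s y := by
  have hd : ∀ x ∈ Ioo a b, HasDerivWithinAt s (derivWithin s (Ioi x) x) (Ioi x) x := fun x hx =>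
    hs.hasDerivWithinAt_rightDeriv_of_mem_interior (by rwa [interior_Icc])
  have hnn : ∀ x ∈ Ioo a b, 0 ≤ derivWithin s (Ioi x) x := by
    intro x hx
    refine ge_of_tendsto ((hasDerivWithinAt_iff_tendsto_slope' self_notMem_Ioi).1 (hd x hx)) ?_
    filter_upwards [Ioc_mem_nhdsGT hx.2] with y hy
    rw [slope_def_field]
    exact div_nonneg (sub_nonneg.2 (hm (Ioo_subset_Icc_self hx)
      ⟨(hx.1.trans hy.1).le, hy.2⟩ hy.1.le)) (sub_nonneg.2 hy.1.le)
  rw [integral_Icc_eq_integral_Ioc, integral_Icc_eq_integral_Ioc,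
    ← intervalIntegral.integral_of_le hab.le, ← intervalIntegral.integral_of_le hab.le]
  refine intervalIntegral.integral_mul_deriv_eq_deriv_mul_of_hasDeriv_right ?_ ?_ ?_ ?_ ?_ ?_
  · rw [uIcc_of_le hab.le]
    exact continuousOn_id.mul hf.continuousOn
  · rwa [uIcc_of_le hab.le]
  · rw [min_eq_left hab.le, max_eq_right hab.le]
    exact fun x hx => (hf.hasDerivAt_id_mul (Ioo_subset_Icc_self hx)).hasDerivWithinAt
  · rwa [min_eq_left hab.le, max_eq_right hab.le]
  · rwa [intervalIntegrable_iff_integrableOn_Icc_of_le hab.le]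
  · rw [intervalIntegrable_iff_integrableOn_Ioc_of_le hab.le]
    exact intervalIntegral.integrableOn_deriv_right_of_nonneg hsc hd hnn

end Density

section Revenue

variable {xA xB yA yC : ℝ} {f1 f2 g1 g2 : ℝ → ℝ} {u v : ℝ × ℝ → ℝ}

theorem integrable_mul_bdd_V (h1 : IntegrableOn g1 (Icc xA xB)) (h2 : IntegrableOn g2 (Icc yA yC))
    {k : ℝ × ℝ → ℝ} (hk : AEStronglyMeasurable k (volume.restrict (V xA xB yA yC))) {c : ℝ}
    (hc : ∀ᵐ z ∂volume.restrict (V xA xB yA yC), |k z| ≤ c) :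
    IntegrableOn (fun z => g1 z.1 * g2 z.2 * k z) (V xA xB yA yC) := by
  have : Integrable (fun z : ℝ × ℝ => g1 z.1 * g2 z.2) (volume.restrict (V xA xB yA yC)) := by
    rw [volume_restrict_V]
    exact Integrable.mul_prod h1 h2
  exact this.mul_bdd hk hc

theorem setIntegral_V_swap (g : ℝ × ℝ → ℝ) :
    ∫ z in V yA yC xA xB, g z.swap = ∫ z in V xA xB yA yC, g z := by
  rw [V_eq_prod, V_eq_prod, Measure.volume_eq_prod]
  exact setIntegral_prod_swap _ _ g

namespace Feasible

theorem aestronglyMeasurable (h : Feasible xA xB yA yC u) :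
    AEStronglyMeasurable u (volume.restrict (V xA xB yA yC)) :=
  h.continuousOn.aestronglyMeasurable measurableSet_V

theorem integrableOn_mul (h : Feasible xA xB yA yC u) (h1 : IntegrableOn g1 (Icc xA xB))
    (h2 : IntegrableOn g2 (Icc yA yC)) :
    IntegrableOn (fun z => g1 z.1 * g2 z.2 * u z) (V xA xB yA yC) := by
  refine integrable_mul_bdd_V (c := u (xA, yA) + (xB - xA) + (yC - yA)) h1 h2
    h.aestronglyMeasurable (ae_restrict_of_forall_mem measurableSet_V fun z hz => ?_)
  rw [abs_of_nonneg (h.1 z hz)]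
  exact (h.bounds hz).2

theorem integrableOn_pd2 (h : Feasible xA xB yA yC u) (hf1 : Density xA xB f1)
    (hf2 : Density yA yC f2) :
    IntegrableOn (fun z => z.2 * pd2 u z * (f1 z.1 * f2 z.2)) (V xA xB yA yC) := by
  have h2 : IntegrableOn (fun y => y * f2 y) (Icc yA yC) :=
    (continuousOn_id.mul hf2.continuousOn).integrableOn_Icc
  have := integrable_mul_bdd_V (c := 1) hf1.integrableOn h2
    (measurable_fderiv_apply_const ℝ u (0, 1)).aestronglyMeasurable (by
      filter_upwards [h.ae_differentiableAt] with z hz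
      have := h.pd2_mem_Icc hz.1 hz.2
      exact abs_le.2 ⟨by linarith [this.1, show pd2 u z = fderiv ℝ u z (0, 1) from rfl], this.2⟩)
  refine this.congr (Filter.Eventually.of_forall fun z => ?_)
  simp only [pd2]
  ring

theorem integral_pd2 (h : Feasible xA xB yA yC u) (hy : yA < yC)
    (hf1 : Density xA xB f1) (hf2 : Density yA yC f2)
    (hint : IntegrableOn (idMulDeriv f2) (Icc yA yC)) :
    ∫ z in V xA xB yA yC, z.2 * pd2 u z * (f1 z.1 * f2 z.2) =
      (∫ x in Icc xA xB, f1 x * (yC * f2 yC * u (x, yC) - yA * f2 yA * u (x, yA))) -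
        ∫ z in V xA xB yA yC, f1 z.1 * idMulDeriv f2 z.2 * u z := by
  have i1 := h.integrableOn_pd2 hf1 hf2
  have i2 := h.integrableOn_mul hf1.integrableOn hint
  have hae := h.ae_differentiableAt
  have hc : ∀ y ∈ Icc yA yC, ContinuousOn (fun x => u (x, y)) (Icc xA xB) := fun y hy =>
    h.continuousOn.comp (by fun_prop) fun x hx => mem_V.2 ⟨hx, hy⟩
  rw [IntegrableOn, volume_restrict_V] at i1 i2
  rw [volume_restrict_V] at hae ⊢
  rw [integral_prod _ i1, integral_prod _ i2, ← integral_sub _ i2.integral_prod_left]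
  · have hae' := Measure.ae_ae_of_ae_prod hae
    refine integral_congr_ae ?_
    filter_upwards [hae', ae_restrict_mem measurableSet_Icc] with x hx hxm
    have hslice : MapsTo (fun y => (x, y)) (Icc yA yC) (V xA xB yA yC) :=
      fun y hy => mem_V.2 ⟨hxm, hy⟩
    have hconv : ConvexOn ℝ (Icc yA yC) fun y => u (x, y) := by
      refine ⟨convex_Icc _ _, fun y hy y' hy' a b ha hb hab => ?_⟩
      have := h.2.1.2 (hslice hy) (hslice hy') ha hb hab
      rwa [Prod.smul_mk, Prod.smul_mk, Prod.mk_add_mk, ← add_smul, hab, one_smul] at this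
    have key := hf2.integral_mul_rightDeriv hy hint hconv
      (h.continuousOn.comp (by fun_prop) hslice)
      fun y hy y' hy' hle => sub_nonneg.1 (h.2.2.2 x y y' hxm hy.1 hle hy'.2).1
    have e1 : ∫ y in Icc yA yC, y * pd2 u (x, y) * (f1 x * f2 y) =
        f1 x * ∫ y in Icc yA yC, y * f2 y * derivWithin (fun y => u (x, y)) (Ioi y) y := by
      rw [← integral_const_mul]
      refine integral_congr_ae ?_
      filter_upwards [hx] with y hy
      have hd : HasDerivAt (fun y => u (x, y)) (pd2 u (x, y)) y :=
        hy.2.hasFDerivAt.comp_hasDerivAt y ((hasDerivAt_const y x).prodMk (hasDerivAt_id y))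
      rw [hd.hasDerivWithinAt.derivWithin (uniqueDiffWithinAt_Ioi y)]
      ring
    have e2 : ∫ y in Icc yA yC, f1 x * idMulDeriv f2 y * u (x, y) =
        f1 x * ∫ y in Icc yA yC, idMulDeriv f2 y * u (x, y) := by
      simp only [mul_assoc, integral_const_mul]
    rw [e1, e2, key]
    ring
  · refine ContinuousOn.integrableOn_Icc (hf1.continuousOn.mul ?_)
    exact (continuousOn_const.mul (hc yC ⟨hy.le, le_rfl⟩)).sub
      (continuousOn_const.mul (hc yA ⟨le_rfl, hy.le⟩))

theorem integrableOn_pd1 (h : Feasible xA xB yA yC u) (hf1 : Density xA xB f1)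
    (hf2 : Density yA yC f2) :
    IntegrableOn (fun z => z.1 * pd1 u z * (f1 z.1 * f2 z.2)) (V xA xB yA yC) := by
  have := h.swap.integrableOn_pd2 hf2 hf1
  rw [IntegrableOn, volume_restrict_V] at this ⊢
  refine this.swap.congr (Filter.Eventually.of_forall fun z => ?_)
  simp only [Function.comp_apply, pd2_comp_swap, Prod.swap_swap, Prod.fst_swap, Prod.snd_swap]
  ring

theorem integral_pd1 (h : Feasible xA xB yA yC u) (hx : xA < xB)
    (hf1 : Density xA xB f1) (hf2 : Density yA yC f2)
    (hint : IntegrableOn (idMulDeriv f1) (Icc xA xB)) :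
    ∫ z in V xA xB yA yC, z.1 * pd1 u z * (f1 z.1 * f2 z.2) =
      (∫ y in Icc yA yC, f2 y * (xB * f1 xB * u (xB, y) - xA * f1 xA * u (xA, y))) -
        ∫ z in V xA xB yA yC, idMulDeriv f1 z.1 * f2 z.2 * u z := by
  have key := h.swap.integral_pd2 hx hf2 hf1 hint
  simp only [pd2_comp_swap, Function.comp_apply, Prod.swap_prod_mk] at key
  rw [← setIntegral_V_swap fun z => z.1 * pd1 u z * (f1 z.1 * f2 z.2),
    ← setIntegral_V_swap fun z => idMulDeriv f1 z.1 * f2 z.2 * u z]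
  simp only [Prod.fst_swap, Prod.snd_swap, mul_comm (idMulDeriv f1 _) (f2 _),
    mul_comm (f1 (Prod.snd _)) (f2 _), key]

/-- Revenue after integrating by parts in each coordinate. -/
theorem rev_eq (h : Feasible xA xB yA yC u) (hx : xA < xB) (hy : yA < yC)
    (hf1 : Density xA xB f1) (hf2 : Density yA yC f2)
    (hint1 : IntegrableOn (idMulDeriv f1) (Icc xA xB))
    (hint2 : IntegrableOn (idMulDeriv f2) (Icc yA yC)) :
    Rev xA xB yA yC f1 f2 u =
      (∫ y in Icc yA yC, f2 y * (xB * f1 xB * u (xB, y) - xA * f1 xA * u (xA, y))) +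
      (∫ x in Icc xA xB, f1 x * (yC * f2 yC * u (x, yC) - yA * f2 yA * u (x, yA))) -
        ∫ z in V xA xB yA yC,
          (idMulDeriv f1 z.1 * f2 z.2 + f1 z.1 * idMulDeriv f2 z.2 + f1 z.1 * f2 z.2) * u z := by
  have i0 := h.integrableOn_mul hf1.integrableOn hf2.integrableOn
  have i1 := h.integrableOn_mul hint1 hf2.integrableOn
  have i2 := h.integrableOn_mul hf1.integrableOn hint2
  have e1 : Rev xA xB yA yC f1 f2 u = (∫ z in V xA xB yA yC, z.1 * pd1 u z * (f1 z.1 * f2 z.2)) +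
      (∫ z in V xA xB yA yC, z.2 * pd2 u z * (f1 z.1 * f2 z.2)) -
        ∫ z in V xA xB yA yC, f1 z.1 * f2 z.2 * u z := by
    rw [← integral_add' (h.integrableOn_pd1 hf1 hf2) (h.integrableOn_pd2 hf1 hf2),
      ← integral_sub' ((h.integrableOn_pd1 hf1 hf2).add (h.integrableOn_pd2 hf1 hf2)) i0, Rev]
    refine integral_congr_ae (Filter.Eventually.of_forall fun z => ?_)
    simp only [Pi.add_apply, Pi.sub_apply]
    ring
  have e2 : ∫ z in V xA xB yA yC,
      (idMulDeriv f1 z.1 * f2 z.2 + f1 z.1 * idMulDeriv f2 z.2 + f1 z.1 * f2 z.2) * u z =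
      (∫ z in V xA xB yA yC, idMulDeriv f1 z.1 * f2 z.2 * u z) +
      (∫ z in V xA xB yA yC, f1 z.1 * idMulDeriv f2 z.2 * u z) +
        ∫ z in V xA xB yA yC, f1 z.1 * f2 z.2 * u z := by
    rw [← integral_add' i1 i2, ← integral_add' (i1.add i2) i0]
    refine integral_congr_ae (Filter.Eventually.of_forall fun z => ?_)
    simp only [Pi.add_apply]
    ring
  rw [e1, e2, h.integral_pd1 hx hf1 hf2 hint1, h.integral_pd2 hy hf1 hf2 hint2]
  ring

end Feasible

theorem eventuallyEq_of_mem_openV (huv : EqOn u v (V xA xB yA yC)) {z : ℝ × ℝ}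
    (hz : z ∈ openV xA xB yA yC) : u =ᶠ[nhds z] v :=
  Filter.eventuallyEq_of_mem (V_mem_nhds hz) huv

theorem rev_congr (huv : EqOn u v (V xA xB yA yC)) :
    Rev xA xB yA yC f1 f2 u = Rev xA xB yA yC f1 f2 v := by
  refine integral_congr_ae ?_
  filter_upwards [ae_mem_openV] with z hz
  simp only [pd1, pd2, (eventuallyEq_of_mem_openV huv hz).fderiv_eq, huv (openV_subset_V hz)]

namespace Feasible

theorem corner_le (h : Feasible xA xB yA yC u) {z : ℝ × ℝ} (hz : z ∈ V xA xB yA yC) :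
    u (xA, yA) ≤ u z := by
  obtain ⟨hx, hy⟩ := mem_V.1 hz
  exact (h.mono_fst le_rfl hx.1 hx.2 ⟨le_rfl, hy.1.trans hy.2⟩).trans
    (h.swap.mono_fst le_rfl hy.1 hy.2 hx)

theorem sub_corner (h : Feasible xA xB yA yC u) :
    Feasible xA xB yA yC fun z => u z - u (xA, yA) := by
  refine ⟨fun z hz => sub_nonneg.2 (h.corner_le hz), h.2.1.sub (concaveOn_const _ convex_V),
    fun x x' y h1 h2 h3 hy => ?_, fun x y y' hx h1 h2 h3 => ?_⟩
  · simpa using h.2.2.1 x x' y h1 h2 h3 hy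
  · simpa using h.2.2.2 x y y' hx h1 h2 h3

theorem integrableOn_rev (h : Feasible xA xB yA yC u) (hf1 : Density xA xB f1)
    (hf2 : Density yA yC f2) :
    IntegrableOn (fun z => (z.1 * pd1 u z + z.2 * pd2 u z - u z) * (f1 z.1 * f2 z.2))
      (V xA xB yA yC) := by
  refine (((h.integrableOn_pd1 hf1 hf2).add (h.integrableOn_pd2 hf1 hf2)).sub
    (h.integrableOn_mul hf1.integrableOn hf2.integrableOn)).congr
    (Filter.Eventually.of_forall fun z => ?_)
  simp only [Pi.add_apply, Pi.sub_apply]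
  ring

theorem rev_le_rev_sub_corner (h : Feasible xA xB yA yC u) (hf1 : Density xA xB f1)
    (hf2 : Density yA yC f2) :
    Rev xA xB yA yC f1 f2 u ≤ Rev xA xB yA yC f1 f2 fun z => u z - u (xA, yA) := by
  refine setIntegral_mono_on (h.integrableOn_rev hf1 hf2) (h.sub_corner.integrableOn_rev hf1 hf2)
    measurableSet_V fun z hz => ?_
  have hz' := mem_V.1 hz
  refine mul_le_mul_of_nonneg_right ?_ (mul_pos (hf1.1 _ hz'.1) (hf2.1 _ hz'.2)).le
  have : 0 ≤ u (xA, yA) := h.1 _ (mem_V.2 ⟨⟨le_rfl, hz'.1.1.trans hz'.1.2⟩,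
    ⟨le_rfl, hz'.2.1.trans hz'.2.2⟩⟩)
  simp only [pd1, pd2, fderiv_sub_const]
  linarith

/-- Raising the utility off the left and bottom edges does not lower revenue. -/
theorem rev_mono (hu : Feasible xA xB yA yC u) (hv : Feasible xA xB yA yC v)
    (h0 : 0 ≤ xA) (h1 : xA < xB) (h2 : 0 ≤ yA) (h3 : yA < yC)
    (hf1 : Density xA xB f1) (hf2 : Density yA yC f2)
    (hint1 : IntegrableOn (idMulDeriv f1) (Icc xA xB))
    (hint2 : IntegrableOn (idMulDeriv f2) (Icc yA yC))
    (hC1 : ∀ x ∈ Icc xA xB, ∀ y ∈ Icc yA yC, PR f1 x + PR f2 y ≤ -3)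
    (hle : ∀ z ∈ V xA xB yA yC, u z ≤ v z)
    (heq : ∀ z ∈ V xA xB yA yC, z.1 = xA ∨ z.2 = yA → v z = u z) :
    Rev xA xB yA yC f1 f2 u ≤ Rev xA xB yA yC f1 f2 v := by
  rw [hu.rev_eq h1 h3 hf1 hf2 hint1 hint2, hv.rev_eq h1 h3 hf1 hf2 hint1 hint2]
  have hxA : xA ∈ Icc xA xB := ⟨le_rfl, h1.le⟩
  have hxB : xB ∈ Icc xA xB := ⟨h1.le, le_rfl⟩
  have hyA : yA ∈ Icc yA yC := ⟨le_rfl, h3.le⟩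
  have hyC : yC ∈ Icc yA yC := ⟨h3.le, le_rfl⟩
  have cx : ∀ {w}, Feasible xA xB yA yC w → ∀ x ∈ Icc xA xB,
      ContinuousOn (fun y => w (x, y)) (Icc yA yC) := fun hw x hx =>
    hw.continuousOn.comp (by fun_prop) fun y hy => mem_V.2 ⟨hx, hy⟩
  have cy : ∀ {w}, Feasible xA xB yA yC w → ∀ y ∈ Icc yA yC,
      ContinuousOn (fun x => w (x, y)) (Icc xA xB) := fun hw y hy =>
    hw.continuousOn.comp (by fun_prop) fun x hx => mem_V.2 ⟨hx, hy⟩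
  have ix : ∀ {w}, Feasible xA xB yA yC w → IntegrableOn
      (fun y => f2 y * (xB * f1 xB * w (xB, y) - xA * f1 xA * w (xA, y))) (Icc yA yC) := fun hw =>
    (hf2.continuousOn.mul ((continuousOn_const.mul (cx hw xB hxB)).sub
      (continuousOn_const.mul (cx hw xA hxA)))).integrableOn_Icc
  have iy : ∀ {w}, Feasible xA xB yA yC w → IntegrableOn
      (fun x => f1 x * (yC * f2 yC * w (x, yC) - yA * f2 yA * w (x, yA))) (Icc xA xB) := fun hw =>
    (hf1.continuousOn.mul ((continuousOn_const.mul (cy hw yC hyC)).sub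
      (continuousOn_const.mul (cy hw yA hyA)))).integrableOn_Icc
  have iz : ∀ {w}, Feasible xA xB yA yC w → IntegrableOn (fun z => (idMulDeriv f1 z.1 * f2 z.2 +
      f1 z.1 * idMulDeriv f2 z.2 + f1 z.1 * f2 z.2) * w z) (V xA xB yA yC) := fun hw => by
    refine (((hw.integrableOn_mul hint1 hf2.integrableOn).add
      (hw.integrableOn_mul hf1.integrableOn hint2)).add
      (hw.integrableOn_mul hf1.integrableOn hf2.integrableOn)).congr
      (Filter.Eventually.of_forall fun z => ?_)
    simp only [Pi.add_apply]
    ring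
  refine sub_le_sub (add_le_add ?_ ?_) ?_
  · refine setIntegral_mono_on (ix hu) (ix hv) measurableSet_Icc fun y hy => ?_
    rw [heq (xA, y) (mem_V.2 ⟨hxA, hy⟩) (Or.inl rfl)]
    have := mul_le_mul_of_nonneg_left (hle (xB, y) (mem_V.2 ⟨hxB, hy⟩))
      (mul_nonneg (h0.trans h1.le) (hf1.1 xB hxB).le)
    exact mul_le_mul_of_nonneg_left (sub_le_sub_right this _) (hf2.1 y hy).le
  · refine setIntegral_mono_on (iy hu) (iy hv) measurableSet_Icc fun x hx => ?_
    rw [heq (x, yA) (mem_V.2 ⟨hx, hyA⟩) (Or.inr rfl)]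
    have := mul_le_mul_of_nonneg_left (hle (x, yC) (mem_V.2 ⟨hx, hyC⟩))
      (mul_nonneg (h2.trans h3.le) (hf2.1 yC hyC).le)
    exact mul_le_mul_of_nonneg_left (sub_le_sub_right this _) (hf1.1 x hx).le
  · refine setIntegral_mono_on (iz hv) (iz hu) measurableSet_V fun z hz => ?_
    obtain ⟨hx, hy⟩ := mem_V.1 hz
    refine mul_le_mul_of_nonpos_left (hle z hz) ?_
    rw [hf1.idMulDeriv_eq hx, hf2.idMulDeriv_eq hy]
    have e : f1 z.1 * (1 + PR f1 z.1) * f2 z.2 + f1 z.1 * (f2 z.2 * (1 + PR f2 z.2)) +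
        f1 z.1 * f2 z.2 = f1 z.1 * f2 z.2 * (3 + (PR f1 z.1 + PR f2 z.2)) := by ring
    rw [e]
    exact mul_nonpos_of_nonneg_of_nonpos (mul_pos (hf1.1 _ hx) (hf2.1 _ hy)).le
      (by linarith [hC1 z.1 hx z.2 hy])

end Feasible

/-- Extension by zero of a bounded continuous function on the valuation rectangle. -/
def extendV (w : BoundedContinuousFunction (V xA xB yA yC) ℝ) (z : ℝ × ℝ) : ℝ :=
  open Classical in if h : z ∈ V xA xB yA yC then w ⟨z, h⟩ else 0

theorem extendV_of_mem (w : BoundedContinuousFunction (V xA xB yA yC) ℝ) {z : ℝ × ℝ}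
    (hz : z ∈ V xA xB yA yC) : extendV w z = w ⟨z, hz⟩ := dif_pos hz

theorem continuous_extendV (z : ℝ × ℝ) :
    Continuous fun w : BoundedContinuousFunction (V xA xB yA yC) ℝ => extendV w z := by
  by_cases hz : z ∈ V xA xB yA yC
  · simp only [extendV_of_mem _ hz]
    exact continuous_eval_const _
  · simp only [extendV, dif_neg hz]
    exact continuous_const

variable (xA xB yA yC) in
/-- Feasible utilities vanishing at the lowest valuation, as bounded continuous functions. -/
def normalizedFeasible : Set (BoundedContinuousFunction (V xA xB yA yC) ℝ) :=
  {w | Feasible xA xB yA yC (extendV w) ∧ extendV w (xA, yA) = 0}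

theorem isClosed_normalizedFeasible : IsClosed (normalizedFeasible xA xB yA yC) := by
  have c := continuous_extendV (xA := xA) (xB := xB) (yA := yA) (yC := yC)
  simp only [normalizedFeasible, Feasible, ConvexOn, Set.ofPred_and, Set.ofPred_forall]
  refine ((isClosed_iInter fun z => isClosed_iInter fun _ => isClosed_le continuous_const (c z)).inter
    ((isClosed_const.inter ?_).inter (IsClosed.inter ?_ ?_))).inter
    (isClosed_eq (c _) continuous_const)
  all_goals
    repeat refine isClosed_iInter fun _ => ?_
  · exact isClosed_le (c _) (by fun_prop)
  · exact (isClosed_le continuous_const ((c _).sub (c _))).inter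
      (isClosed_le ((c _).sub (c _)) continuous_const)
  · exact (isClosed_le continuous_const ((c _).sub (c _))).inter
      (isClosed_le ((c _).sub (c _)) continuous_const)

theorem extendV_mem_Icc {w : BoundedContinuousFunction (V xA xB yA yC) ℝ}
    (hw : w ∈ normalizedFeasible xA xB yA yC) {z : ℝ × ℝ} (hz : z ∈ V xA xB yA yC) :
    extendV w z ∈ Icc 0 ((xB - xA) + (yC - yA)) := by
  have := hw.1.bounds hz
  rwa [hw.2, zero_add] at this

theorem isCompact_normalizedFeasible : IsCompact (normalizedFeasible xA xB yA yC) := by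
  have : CompactSpace (V xA xB yA yC) := isCompact_iff_compactSpace.1 isCompact_V
  refine BoundedContinuousFunction.arzela_ascoli₂ (Icc 0 ((xB - xA) + (yC - yA))) isCompact_Icc _
    isClosed_normalizedFeasible (fun w z hw => ?_) ?_
  · rw [← extendV_of_mem w z.2]
    exact extendV_mem_Icc hw z.2
  · refine (LipschitzWith.uniformEquicontinuous _ 2 fun w => ?_).equicontinuous
    have := w.2.1.lipschitzOnWith.to_restrict
    convert this using 1
    ext z
    exact (extendV_of_mem _ z.2).symm

theorem continuousOn_integral_extendV {α : Type*} [TopologicalSpace α] [MeasurableSpace α]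
    [OpensMeasurableSpace α] {μ : Measure α} {s : Set α} (hs : MeasurableSet s) {k : α → ℝ}
    (hk : IntegrableOn k s μ) {p q : α → ℝ × ℝ} (hp : ContinuousOn p s) (hq : ContinuousOn q s)
    (hpV : MapsTo p s (V xA xB yA yC)) (hqV : MapsTo q s (V xA xB yA yC)) (c d : ℝ) :
    ContinuousOn (fun w : BoundedContinuousFunction (V xA xB yA yC) ℝ =>
      ∫ t in s, k t * (c * extendV w (p t) - d * extendV w (q t)) ∂μ)
      (normalizedFeasible xA xB yA yC) := by
  set D := (xB - xA) + (yC - yA)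
  refine continuousOn_of_dominated (bound := fun t => |k t| * (|c| * D + |d| * D)) (fun w hw => ?_)
    (fun w hw => ?_) ?_ ?_
  · refine hk.aestronglyMeasurable.mul (ContinuousOn.aestronglyMeasurable ?_ hs)
    exact (continuousOn_const.mul (hw.1.continuousOn.comp hp hpV)).sub
      (continuousOn_const.mul (hw.1.continuousOn.comp hq hqV))
  · refine ae_restrict_of_forall_mem hs fun t ht => ?_
    rw [Real.norm_eq_abs, abs_mul]
    refine mul_le_mul_of_nonneg_left ?_ (abs_nonneg _)
    refine (abs_sub _ _).trans (add_le_add ?_ ?_)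
    · have := extendV_mem_Icc hw (hpV ht)
      rw [abs_mul, abs_of_nonneg this.1]
      exact mul_le_mul_of_nonneg_left this.2 (abs_nonneg _)
    · have := extendV_mem_Icc hw (hqV ht)
      rw [abs_mul, abs_of_nonneg this.1]
      exact mul_le_mul_of_nonneg_left this.2 (abs_nonneg _)
  · exact hk.abs.mul_const _
  · refine Filter.Eventually.of_forall fun t => Continuous.continuousOn ?_
    exact continuous_const.mul ((continuous_const.mul (continuous_extendV _)).sub
      (continuous_const.mul (continuous_extendV _)))

theorem continuousOn_rev_extendV (h1 : xA < xB) (h3 : yA < yC)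
    (hf1 : Density xA xB f1) (hf2 : Density yA yC f2)
    (hint1 : IntegrableOn (idMulDeriv f1) (Icc xA xB))
    (hint2 : IntegrableOn (idMulDeriv f2) (Icc yA yC)) :
    ContinuousOn (fun w : BoundedContinuousFunction (V xA xB yA yC) ℝ =>
      Rev xA xB yA yC f1 f2 (extendV w)) (normalizedFeasible xA xB yA yC) := by
  refine ContinuousOn.congr ?_ fun w hw => hw.1.rev_eq h1 h3 hf1 hf2 hint1 hint2
  have hk : IntegrableOn (fun z : ℝ × ℝ => idMulDeriv f1 z.1 * f2 z.2 +
      f1 z.1 * idMulDeriv f2 z.2 + f1 z.1 * f2 z.2) (V xA xB yA yC) := by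
    rw [IntegrableOn, volume_restrict_V]
    exact ((hint1.mul_prod hf2.integrableOn).add (hf1.integrableOn.mul_prod hint2)).add
      (hf1.integrableOn.mul_prod hf2.integrableOn)
  refine ContinuousOn.sub (ContinuousOn.add ?_ ?_) ?_
  · exact continuousOn_integral_extendV measurableSet_Icc hf2.integrableOn
      (p := fun y => (xB, y)) (q := fun y => (xA, y)) (by fun_prop) (by fun_prop)
      (fun y hy => mem_V.2 ⟨⟨h1.le, le_rfl⟩, hy⟩)
      (fun y hy => mem_V.2 ⟨⟨le_rfl, h1.le⟩, hy⟩) _ _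
  · exact continuousOn_integral_extendV measurableSet_Icc hf1.integrableOn
      (p := fun x => (x, yC)) (q := fun x => (x, yA)) (by fun_prop) (by fun_prop)
      (fun x hx => mem_V.2 ⟨hx, ⟨h3.le, le_rfl⟩⟩)
      (fun x hx => mem_V.2 ⟨hx, ⟨le_rfl, h3.le⟩⟩) _ _
  · simpa only [one_mul, zero_mul, sub_zero, id] using continuousOn_integral_extendV
      measurableSet_V hk continuousOn_id continuousOn_id (mapsTo_id _) (mapsTo_id _) 1 0

/-- Some feasible utility maximizes revenue. -/
theorem exists_feasible_forall_rev_le (h1 : xA < xB) (h3 : yA < yC)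
    (hf1 : Density xA xB f1) (hf2 : Density yA yC f2)
    (hint1 : IntegrableOn (idMulDeriv f1) (Icc xA xB))
    (hint2 : IntegrableOn (idMulDeriv f2) (Icc yA yC)) :
    ∃ u, Feasible xA xB yA yC u ∧
      ∀ v, Feasible xA xB yA yC v → Rev xA xB yA yC f1 f2 v ≤ Rev xA xB yA yC f1 f2 u := by
  have : CompactSpace (V xA xB yA yC) := isCompact_iff_compactSpace.1 isCompact_V
  have lift : ∀ v, Feasible xA xB yA yC v → ∃ w ∈ normalizedFeasible xA xB yA yC,
      Rev xA xB yA yC f1 f2 v ≤ Rev xA xB yA yC f1 f2 (extendV w) := by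
    intro v hv
    have hv' := hv.sub_corner
    set w := BoundedContinuousFunction.mkOfCompact ⟨_, hv'.continuousOn.domRestrict⟩
    have hw : EqOn (fun z => v z - v (xA, yA)) (extendV w) (V xA xB yA yC) := fun z hz => by
      rw [extendV_of_mem w hz]
      rfl
    refine ⟨w, ⟨hv'.congr hw, ?_⟩, ?_⟩
    · rw [← hw (mem_V.2 ⟨⟨le_rfl, h1.le⟩, ⟨le_rfl, h3.le⟩⟩)]
      exact sub_self _
    · rw [← rev_congr hw]
      exact hv.rev_le_rev_sub_corner hf1 hf2
  have hzero : Feasible xA xB yA yC fun _ => 0 :=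
    ⟨fun _ _ => le_rfl, convexOn_const _ convex_V, fun _ _ _ _ h _ _ => by simpa using h,
      fun _ _ _ _ _ h _ => by simpa using h⟩
  obtain ⟨w₀, hw₀, -⟩ := lift _ hzero
  obtain ⟨w, hw, hmax⟩ := isCompact_normalizedFeasible.exists_isMaxOn ⟨w₀, hw₀⟩
    (continuousOn_rev_extendV h1 h3 hf1 hf2 hint1 hint2)
  refine ⟨extendV w, hw.1, fun v hv => ?_⟩
  obtain ⟨w', hw', hle⟩ := lift v hv
  exact hle.trans (hmax hw')

variable (xA xB yA yC u) in
/-- The feasible utilities that do not exceed `u` on the left and bottom edges. -/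
def edgeDominated : Set (ℝ × ℝ → ℝ) :=
  {v | Feasible xA xB yA yC v ∧ ∀ z ∈ V xA xB yA yC, z.1 = xA ∨ z.2 = yA → v z ≤ u z}

variable (xA xB yA yC u) in
/-- The largest feasible utility that does not exceed `u` on the left and bottom edges. -/
def envelope (z : ℝ × ℝ) : ℝ := sSup ((fun v => v z) '' edgeDominated xA xB yA yC u)

theorem le_envelope (hv : v ∈ edgeDominated xA xB yA yC u) {z : ℝ × ℝ}
    (hz : z ∈ V xA xB yA yC) : v z ≤ envelope xA xB yA yC u z := by
  refine le_csSup ⟨u (xA, yA) + (xB - xA) + (yC - yA), ?_⟩ (mem_image_of_mem _ hv)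
  rintro _ ⟨w, hw, rfl⟩
  obtain ⟨hx, hy⟩ := mem_V.1 hz
  have := hw.2 (xA, yA) (mem_V.2 ⟨⟨le_rfl, hx.1.trans hx.2⟩, ⟨le_rfl, hy.1.trans hy.2⟩⟩)
    (Or.inl rfl)
  linarith [(hw.1.bounds hz).2]

namespace Feasible

theorem envelope_le (h : Feasible xA xB yA yC u) {z : ℝ × ℝ} {c : ℝ}
    (hc : ∀ v ∈ edgeDominated xA xB yA yC u, v z ≤ c) : envelope xA xB yA yC u z ≤ c :=
  csSup_le (Nonempty.image _ ⟨u, h, fun _ _ _ => le_rfl⟩) (forall_mem_image.2 hc)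

theorem le_envelope (h : Feasible xA xB yA yC u) {z : ℝ × ℝ} (hz : z ∈ V xA xB yA yC) :
    u z ≤ envelope xA xB yA yC u z :=
  _root_.le_envelope ⟨h, fun _ _ _ => le_rfl⟩ hz

theorem envelope_eq (h : Feasible xA xB yA yC u) {z : ℝ × ℝ} (hz : z ∈ V xA xB yA yC)
    (he : z.1 = xA ∨ z.2 = yA) : envelope xA xB yA yC u z = u z :=
  le_antisymm (h.envelope_le fun _ hv => hv.2 z hz he) (h.le_envelope hz)

theorem feasible_envelope (h : Feasible xA xB yA yC u) :
    Feasible xA xB yA yC (envelope xA xB yA yC u) := by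
  refine ⟨fun z hz => (h.1 z hz).trans (h.le_envelope hz),
    ⟨convex_V, fun z hz w hw a b ha hb hab => h.envelope_le fun v hv => ?_⟩,
    fun x x' y h1 h2 h3 hy => ?_, fun x y y' hx h1 h2 h3 => ?_⟩
  · refine (hv.1.2.1.2 hz hw ha hb hab).trans (add_le_add ?_ ?_)
    · exact mul_le_mul_of_nonneg_left (_root_.le_envelope hv hz) ha
    · exact mul_le_mul_of_nonneg_left (_root_.le_envelope hv hw) hb
  · have m : (x, y) ∈ V xA xB yA yC := mem_V.2 ⟨⟨h1, h2.trans h3⟩, hy⟩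
    have m' : (x', y) ∈ V xA xB yA yC := mem_V.2 ⟨⟨h1.trans h2, h3⟩, hy⟩
    rw [sub_nonneg, sub_le_iff_le_add]
    constructor <;> refine h.envelope_le fun v hv => ?_
    · linarith [_root_.le_envelope hv m', (hv.1.2.2.1 x x' y h1 h2 h3 hy).1]
    · linarith [_root_.le_envelope hv m, (hv.1.2.2.1 x x' y h1 h2 h3 hy).2]
  · have m : (x, y) ∈ V xA xB yA yC := mem_V.2 ⟨hx, ⟨h1, h2.trans h3⟩⟩
    have m' : (x, y') ∈ V xA xB yA yC := mem_V.2 ⟨hx, ⟨h1.trans h2, h3⟩⟩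
    rw [sub_nonneg, sub_le_iff_le_add]
    constructor <;> refine h.envelope_le fun v hv => ?_
    · linarith [_root_.le_envelope hv m', (hv.1.2.2.2 x y y' hx h1 h2 h3).1]
    · linarith [_root_.le_envelope hv m, (hv.1.2.2.2 x y y' hx h1 h2 h3).2]

end Feasible

theorem feasible_max_zero_affine {a b : ℝ} (ha : a ∈ Icc (0 : ℝ) 1) (hb : b ∈ Icc (0 : ℝ) 1)
    (m : ℝ) :
    Feasible xA xB yA yC fun z => max 0 (a * (z.1 - xA) + b * (z.2 - yA) - m) := by
  have key : ∀ {c p q r s : ℝ}, c ∈ Icc (0 : ℝ) 1 → p ≤ q → s - r = c * (q - p) →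
      0 ≤ max 0 s - max 0 r ∧ max 0 s - max 0 r ≤ q - p := by
    intro c p q r s hc hpq hs
    have e1 : 0 ≤ c * (q - p) := mul_nonneg hc.1 (sub_nonneg.2 hpq)
    have e2 : c * (q - p) ≤ q - p := mul_le_of_le_one_left (sub_nonneg.2 hpq) hc.2
    rcases max_cases 0 s with ⟨h, _⟩ | ⟨h, _⟩ <;> rcases max_cases 0 r with ⟨h', _⟩ | ⟨h', _⟩ <;>
      rw [h, h'] <;> constructor <;> linarith
  refine ⟨fun z _ => le_max_left _ _, (convexOn_const 0 convex_V).sup ⟨convex_V, ?_⟩,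
    fun x x' y _ h _ _ => key ha h (by ring), fun x y y' _ _ h _ => key hb h (by ring)⟩
  intro z _ w _ r s _ _ hrs
  have : s = 1 - r := by linarith
  subst this
  simp only [Prod.fst_add, Prod.snd_add, Prod.smul_fst, Prod.smul_snd, smul_eq_mul]
  exact le_of_eq (by ring)

/-- A contract that no type on the left and bottom edges prefers is weakly rejected by all. -/
theorem Feasible.affine_le_envelope (h : Feasible xA xB yA yC u) {a b m : ℝ}
    (ha : a ∈ Icc (0 : ℝ) 1) (hb : b ∈ Icc (0 : ℝ) 1)
    (hleft : ∀ y ∈ Icc yA yC, b * (y - yA) - m ≤ envelope xA xB yA yC u (xA, y))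
    (hbot : ∀ x ∈ Icc xA xB, a * (x - xA) - m ≤ envelope xA xB yA yC u (x, yA))
    {z : ℝ × ℝ} (hz : z ∈ V xA xB yA yC) :
    a * (z.1 - xA) + b * (z.2 - yA) - m ≤ envelope xA xB yA yC u z := by
  have hmem : (fun z : ℝ × ℝ => max 0 (a * (z.1 - xA) + b * (z.2 - yA) - m)) ∈
      edgeDominated xA xB yA yC u := by
    refine ⟨feasible_max_zero_affine ha hb m, fun w hw he => max_le (h.1 w hw) ?_⟩
    obtain ⟨hx, hy⟩ := mem_V.1 hw
    rw [← h.envelope_eq hw he]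
    rcases he with he | he
    · have := hleft w.2 hy
      rw [show (xA, w.2) = w from Prod.ext he.symm rfl] at this
      linarith [show a * (w.1 - xA) = 0 by rw [he]; ring]
    · have := hbot w.1 hx
      rw [show (w.1, yA) = w from Prod.ext rfl he.symm] at this
      linarith [show b * (w.2 - yA) = 0 by rw [he]; ring]
  exact (le_max_right 0 _).trans (_root_.le_envelope hmem hz)

variable (xA yA u) in
/-- The utility lost by the lowest type when it buys the contract chosen by the type `z`. -/
def cornerLoss (z : ℝ × ℝ) : ℝ := pay u z - pd1 u z * xA - pd2 u z * yA

theorem Feasible.affine_le_of_differentiableAt (h : Feasible xA xB yA yC u) {z w : ℝ × ℝ}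
    (hz : z ∈ V xA xB yA yC) (hd : DifferentiableAt ℝ u z) (hw : w ∈ V xA xB yA yC) :
    pd1 u z * (w.1 - xA) + pd2 u z * (w.2 - yA) - cornerLoss xA yA u z ≤ u w := by
  have := h.add_fderiv_le hz hd hw
  rw [cornerLoss, pay]
  linarith

/-- In the envelope's menu, a larger corner loss buys a larger allocation of both items. -/
theorem Feasible.pd_le_pd_of_cornerLoss_le (h : Feasible xA xB yA yC u) {z z' : ℝ × ℝ}
    (hz : z ∈ openV xA xB yA yC) (hz' : z' ∈ openV xA xB yA yC)
    (hd : DifferentiableAt ℝ (envelope xA xB yA yC u) z)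
    (hd' : DifferentiableAt ℝ (envelope xA xB yA yC u) z')
    (hle : cornerLoss xA yA (envelope xA xB yA yC u) z ≤
      cornerLoss xA yA (envelope xA xB yA yC u) z') :
    pd1 (envelope xA xB yA yC u) z ≤ pd1 (envelope xA xB yA yC u) z' ∧
      pd2 (envelope xA xB yA yC u) z ≤ pd2 (envelope xA xB yA yC u) z' := by
  set e := envelope xA xB yA yC u
  have he : Feasible xA xB yA yC e := h.feasible_envelope
  have hzV := openV_subset_V hz
  have hzV' := openV_subset_V hz'
  obtain ⟨hx, hy⟩ := mem_V.1 hzV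
  have hxA : xA ∈ Icc xA xB := ⟨le_rfl, hx.1.trans hx.2⟩
  have hyA : yA ∈ Icc yA yC := ⟨le_rfl, hy.1.trans hy.2⟩
  have left : ∀ p ∈ openV xA xB yA yC, DifferentiableAt ℝ e p → ∀ y ∈ Icc yA yC,
      pd2 e p * (y - yA) - cornerLoss xA yA e p ≤ e (xA, y) := fun p hp hdp y hy => by
    simpa using he.affine_le_of_differentiableAt (openV_subset_V hp) hdp
      (w := (xA, y)) (mem_V.2 ⟨hxA, hy⟩)
  have bot : ∀ p ∈ openV xA xB yA yC, DifferentiableAt ℝ e p → ∀ x ∈ Icc xA xB,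
      pd1 e p * (x - xA) - cornerLoss xA yA e p ≤ e (x, yA) := fun p hp hdp x hx => by
    simpa using he.affine_le_of_differentiableAt (openV_subset_V hp) hdp
      (w := (x, yA)) (mem_V.2 ⟨hx, hyA⟩)
  have self : e z' = pd1 e z' * (z'.1 - xA) + pd2 e z' * (z'.2 - yA) - cornerLoss xA yA e z' := by
    rw [cornerLoss, pay]
    ring
  constructor
  · by_contra! hlt
    have := h.affine_le_envelope (he.pd1_mem_Icc hz hd) (he.pd2_mem_Icc hz' hd')
      (left z' hz' hd') (fun x hx => by linarith [bot z hz hd x hx]) hzV'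
    nlinarith [mul_pos (sub_pos.2 hlt) (sub_pos.2 hz'.1.1)]
  · by_contra! hlt
    have := h.affine_le_envelope (he.pd1_mem_Icc hz' hd') (he.pd2_mem_Icc hz hd)
      (fun y hy => by linarith [left z hz hd y hy]) (bot z' hz' hd') hzV'
    nlinarith [mul_pos (sub_pos.2 hlt) (sub_pos.2 hz'.2.1)]

/-- The envelope's menu is monotone. -/
theorem Feasible.menu_monotone_envelope (h : Feasible xA xB yA yC u) (h0 : 0 ≤ xA) (h2 : 0 ≤ yA)
    {z z' : ℝ × ℝ} (hz : z ∈ openV xA xB yA yC) (hz' : z' ∈ openV xA xB yA yC)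
    (hd : DifferentiableAt ℝ (envelope xA xB yA yC u) z)
    (hd' : DifferentiableAt ℝ (envelope xA xB yA yC u) z')
    (hpay : pay (envelope xA xB yA yC u) z ≤ pay (envelope xA xB yA yC u) z') :
    pd1 (envelope xA xB yA yC u) z ≤ pd1 (envelope xA xB yA yC u) z' ∧
      pd2 (envelope xA xB yA yC u) z ≤ pd2 (envelope xA xB yA yC u) z' := by
  rcases le_total (cornerLoss xA yA (envelope xA xB yA yC u) z)
    (cornerLoss xA yA (envelope xA xB yA yC u) z') with hle | hle
  · exact h.pd_le_pd_of_cornerLoss_le hz hz' hd hd' hle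
  · have hp := h.pd_le_pd_of_cornerLoss_le hz' hz hd' hd hle
    refine h.pd_le_pd_of_cornerLoss_le hz hz' hd hd' ?_
    have e1 := mul_le_mul_of_nonneg_right hp.1 h0
    have e2 := mul_le_mul_of_nonneg_right hp.2 h2
    rw [cornerLoss, cornerLoss]
    linarith

/-- A function that is nonnegative on the rectangle and negative off it is not differentiable
at the boundary. -/
theorem mem_openV_of_differentiableAt (hn : ∀ z ∈ V xA xB yA yC, 0 ≤ u z)
    (hneg : ∀ z ∉ V xA xB yA yC, u z = -1) {z : ℝ × ℝ} (hz : z ∈ V xA xB yA yC)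
    (hd : DifferentiableAt ℝ u z) : z ∈ openV xA xB yA yC := by
  rw [← interior_V, mem_interior_iff_mem_nhds]
  filter_upwards [hd.continuousAt.eventually (lt_mem_nhds (neg_one_lt_zero.trans_le (hn z hz)))]
    with w hw
  by_contra hwV
  exact hw.ne' (hneg w hwV)

end Revenue

/-- Menu Monotonicity: under Condition 1 there is an optimal feasible
utility whose menu is monotone: higher payment means (weakly) higher allocation
probabilities, and equal payment means equal allocation. -/
theorem stmt4 (xA xB yA yC : ℝ) (h0 : 0 ≤ xA) (h1 : xA < xB) (h2 : 0 ≤ yA) (h3 : yA < yC)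
    (f1 f2 : ℝ → ℝ) (hf1 : Density xA xB f1) (hf2 : Density yA yC f2)
    (hC1 : ∀ x ∈ Set.Icc xA xB, ∀ y ∈ Set.Icc yA yC, PR f1 x + PR f2 y ≤ -3) :
    ∃ u : ℝ × ℝ → ℝ, Optimal xA xB yA yC f1 f2 u ∧
      ∀ z ∈ V xA xB yA yC, ∀ z' ∈ V xA xB yA yC,
        DifferentiableAt ℝ u z → DifferentiableAt ℝ u z' →
        (pay u z < pay u z' → pd1 u z ≤ pd1 u z' ∧ pd2 u z ≤ pd2 u z') ∧
        (pay u z = pay u z' → pd1 u z = pd1 u z' ∧ pd2 u z = pd2 u z') := by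
  have hxA : xA ∈ Icc xA xB := ⟨le_rfl, h1.le⟩
  have hyA : yA ∈ Icc yA yC := ⟨le_rfl, h3.le⟩
  have hint1 := hf1.integrableOn_idMulDeriv (C := -3 - PR f2 yA)
    fun x hx => by linarith [hC1 x hx yA hyA]
  have hint2 := hf2.integrableOn_idMulDeriv (C := -3 - PR f1 xA)
    fun y hy => by linarith [hC1 xA hxA y hy]
  obtain ⟨u, hu, hmax⟩ := exists_feasible_forall_rev_le h1 h3 hf1 hf2 hint1 hint2
  have he := hu.feasible_envelope
  set e := envelope xA xB yA yC u
  classical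
  set w : ℝ × ℝ → ℝ := fun z => if z ∈ V xA xB yA yC then e z else -1
  have hew : EqOn e w (V xA xB yA yC) := fun z hz => (if_pos hz).symm
  have hw := he.congr hew
  refine ⟨w, ⟨hw, ?_⟩, fun z hz z' hz' hd hd' => ?_⟩
  · have hrev : Rev xA xB yA yC f1 f2 u ≤ Rev xA xB yA yC f1 f2 w := by
      rw [← rev_congr hew]
      exact hu.rev_mono he h0 h1 h2 h3 hf1 hf2 hint1 hint2 hC1 (fun z hz => hu.le_envelope hz)
        fun z hz hedge => hu.envelope_eq hz hedge
    rw [OptRev]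
    refine Eq.symm (IsGreatest.csSup_eq ⟨⟨w, hw, rfl⟩, ?_⟩)
    rintro _ ⟨v, hv, rfl⟩
    exact (hmax v hv).trans hrev
  · have key : ∀ p ∈ V xA xB yA yC, DifferentiableAt ℝ w p → p ∈ openV xA xB yA yC ∧
        DifferentiableAt ℝ e p ∧ pd1 w p = pd1 e p ∧ pd2 w p = pd2 e p ∧ pay w p = pay e p := by
      intro p hp hdp
      have hpo := mem_openV_of_differentiableAt hw.1 (fun q hq => if_neg hq) hp hdp
      have heq := eventuallyEq_of_mem_openV hew hpo
      refine ⟨hpo, hdp.congr_of_eventuallyEq heq, ?_, ?_, ?_⟩ <;>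
        simp only [pay, pd1, pd2, heq.fderiv_eq, hew hp]
    obtain ⟨ho, hde, e1, e2, e3⟩ := key z hz hd
    obtain ⟨ho', hde', e1', e2', e3'⟩ := key z' hz' hd'
    rw [e1, e2, e3, e1', e2', e3']
    have mono := hu.menu_monotone_envelope h0 h2 ho ho' hde hde'
    have mono' := hu.menu_monotone_envelope h0 h2 ho' ho hde' hde
    exact ⟨fun h => mono h.le, fun h => ⟨le_antisymm (mono h.le).1 (mono' h.ge).1,
      le_antisymm (mono h.le).2 (mono' h.ge).2⟩⟩
end
end

section
/- Let M ⊆ [0,1]² × ℝ be a menu with finite induced utility u. Suppose an item (1,a,t) is chosen at (x₂,y₂) and an item (b,1,t') is chosen at (x₃,y₃). Then (1 − b)·(x₂ − x₃) + (1 − a)·(y₃ − y₂) ≥ 0. In particular, if a < 1 and b < 1, then it is not the case that both x₂ < x₃ and y₂ > y₃. -/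
open Set

noncomputable section

/-- A menu: a nonempty set of items `(q₁,q₂,t)` with `q₁,q₂ ∈ [0,1]`. -/
def MenuSet (M : Set (ℝ × ℝ × ℝ)) : Prop :=
  M.Nonempty ∧ ∀ m ∈ M, m.1 ∈ Set.Icc (0:ℝ) 1 ∧ m.2.1 ∈ Set.Icc (0:ℝ) 1

/-- The utility a buyer of type `(x,y)` derives from item `m = (q₁,q₂,t)`. -/
def itemU (m : ℝ × ℝ × ℝ) (x y : ℝ) : ℝ := m.1 * x + m.2.1 * y - m.2.2

/-- The induced buyer utility of a menu: `u(x,y) = sup_{(q₁,q₂,t) ∈ M} (q₁x + q₂y − t)`. -/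
def menuU (M : Set (ℝ × ℝ × ℝ)) (x y : ℝ) : ℝ :=
  sSup ((fun m => itemU m x y) '' M)

/-- The induced utility is finite (the supremum is over a bounded-above set). -/
def FiniteU (M : Set (ℝ × ℝ × ℝ)) : Prop :=
  ∀ x y, BddAbove ((fun m => itemU m x y) '' M)

/-- An item is chosen at `(x,y)` if it attains the supremum defining `menuU`. -/
def Chosen (M : Set (ℝ × ℝ × ℝ)) (m : ℝ × ℝ × ℝ) (x y : ℝ) : Prop :=
  m ∈ M ∧ menuU M x y = itemU m x y

/-- A chosen item gives at least as much utility as any other item of the menu. -/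
theorem Chosen.itemU_le {M : Set (ℝ × ℝ × ℝ)} {m n : ℝ × ℝ × ℝ} {x y : ℝ}
    (h : Chosen M m x y) (hfin : FiniteU M) (hn : n ∈ M) : itemU n x y ≤ itemU m x y :=
  h.2 ▸ le_csSup (hfin x y) (mem_image_of_mem _ hn)

/-- if `(1,a,t)` is chosen at `(x₂,y₂)` and `(b,1,t')` is chosen at
`(x₃,y₃)`, then `(1−b)(x₂−x₃) + (1−a)(y₃−y₂) ≥ 0`; in particular if `a < 1` and
`b < 1` it is not the case that both `x₂ < x₃` and `y₂ > y₃`. -/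
theorem stmt9 (M : Set (ℝ × ℝ × ℝ)) (hM : MenuSet M) (hfin : FiniteU M)
    (a t x2 y2 : ℝ) (h1 : Chosen M (1, a, t) x2 y2)
    (b t' x3 y3 : ℝ) (h2 : Chosen M (b, 1, t') x3 y3) :
    (1 - b) * (x2 - x3) + (1 - a) * (y3 - y2) ≥ 0 ∧
    (a < 1 → b < 1 → ¬(x2 < x3 ∧ y3 < y2)) := by
  have hsum := add_le_add (h1.itemU_le hfin h2.1) (h2.itemU_le hfin h1.1)
  simp only [itemU] at hsum
  have key : (1 - b) * (x2 - x3) + (1 - a) * (y3 - y2) ≥ 0 := by linarith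
  refine ⟨key, fun ha hb ⟨hx, hy⟩ => ?_⟩
  have hbx := mul_pos (sub_pos.2 hb) (sub_pos.2 hx)
  have hay := mul_pos (sub_pos.2 ha) (sub_pos.2 hy)
  linarith
end
end

section
/- Assume Conditions 2 and 3. Then there exists an optimal feasible utility function u whose restrictions to the right edge and to the top edge of V are each piecewise linear with at most two pieces: there exist c ∈ [y_A,y_C] and d ∈ [x_A,x_B] such that y ↦ u(x_B,y) is affine on [y_A,c] and affine on [c,y_C], and x ↦ u(x,y_C) is affine on [x_A,d] and affine on [d,x_B]. -/
open MeasureTheory Set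

noncomputable section

/-- All increments of `g` lie between `0` and the increment of the argument. -/
def UnitIncr (g : ℝ → ℝ) : Prop := ∀ s t, s ≤ t → 0 ≤ g t - g s ∧ g t - g s ≤ t - s

/-- Increments of `u` in each coordinate lie between `0` and the coordinate increment. -/
def UnitIncr₂ (u : ℝ × ℝ → ℝ) : Prop :=
  (∀ y, UnitIncr fun x => u (x, y)) ∧ ∀ x, UnitIncr fun y => u (x, y)

lemma UnitIncr.lipschitz {g : ℝ → ℝ} (hg : UnitIncr g) : LipschitzWith 1 g := by
  refine LipschitzWith.of_dist_le_mul fun s t => ?_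
  rw [NNReal.coe_one, one_mul, Real.dist_eq, Real.dist_eq]
  rcases le_total s t with h | h
  · have := hg s t h
    rw [abs_sub_comm, abs_of_nonneg this.1, abs_sub_comm, abs_of_nonneg (by linarith)]
    exact this.2
  · have := hg t s h
    rw [abs_of_nonneg this.1, abs_of_nonneg (by linarith)]
    exact this.2

lemma UnitIncr₂.lipschitz {u : ℝ × ℝ → ℝ} (hu : UnitIncr₂ u) : LipschitzWith 2 u := by
  refine LipschitzWith.of_dist_le_mul fun p q => ?_
  have e1 := (hu.1 p.2).lipschitz.dist_le_mul p.1 q.1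
  have e2 := (hu.2 q.1).lipschitz.dist_le_mul p.2 q.2
  have d1 : dist p.1 q.1 ≤ dist p q := le_max_left _ _
  have d2 : dist p.2 q.2 ≤ dist p q := le_max_right _ _
  have := dist_triangle (u (p.1, p.2)) (u (q.1, p.2)) (u (q.1, q.2))
  simp only [NNReal.coe_one, one_mul, Prod.mk.eta] at *
  norm_num
  linarith

/-- A continuous nonnegative density on `[a,b]` with `(x F)' = (1 + κ) F` in integrated form. -/
structure PowerDensity (a b κ : ℝ) (F : ℝ → ℝ) : Prop where
  nonneg_left : 0 ≤ a
  lt : a < b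
  cont : Continuous F
  nonneg : ∀ x, 0 ≤ F x
  integral_eq_one : ∫ x in a..b, F x = 1
  parts : ∀ φ : ℝ → ℝ, LipschitzWith 1 φ →
    ∫ x in a..b, x * F x * deriv φ x =
      b * F b * φ b - a * F a * φ a - (1 + κ) * ∫ x in a..b, F x * φ x

lemma exists_powerDensity {a b κ : ℝ} {f : ℝ → ℝ} (ha : 0 ≤ a) (hab : a < b)
    (hf : Density a b f) (hκ : ∀ x ∈ Icc a b, PR f x = κ) :
    ∃ F, PowerDensity a b κ F ∧ ∀ x ∈ Icc a b, F x = f x := by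
  obtain ⟨hpos, -, hdiff, hint⟩ := hf
  have hcont : ContinuousOn f (Icc a b) := fun x hx => (hdiff x hx).continuousAt.continuousWithinAt
  set F := IccExtend hab.le ((Icc a b).domRestrict f) with hF
  have hFf : ∀ x ∈ Icc a b, F x = f x := fun x hx => by
    rw [hF, IccExtend_of_mem _ _ hx]; rfl
  have huIcc : uIcc a b = Icc a b := uIcc_of_le hab.le
  refine ⟨F, ⟨ha, hab, hcont.domRestrict.Icc_extend', ?_, ?_, ?_⟩, hFf⟩
  · intro x
    exact (hpos _ (projIcc a b hab.le x).2).le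
  · rw [← hint]
    exact intervalIntegral.integral_congr fun x hx => hFf x (huIcc ▸ hx)
  · intro φ hφ
    have hderiv : ∀ x ∈ Icc a b, HasDerivAt (fun x => x * f x) ((1 + κ) * f x) x := by
      intro x hx
      have h := (hasDerivAt_id x).mul (hdiff x hx).hasDerivAt
      have hk : x * deriv f x = κ * f x := by
        rw [← hκ x hx, PR, div_mul_cancel₀ _ (hpos x hx).ne']
      refine HasDerivAt.congr_deriv (f := fun x => x * f x) h ?_
      rw [one_mul, id, hk]
      ring
    have hac : AbsolutelyContinuousOnInterval (fun x => x * f x) a b := by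
      obtain ⟨C, hC⟩ := isCompact_Icc.exists_bound_of_continuousOn
        (hcont.const_smul (1 + κ))
      have : LipschitzOnWith C.toNNReal (fun x => x * f x) (Icc a b) := by
        refine Convex.lipschitzOnWith_of_nnnorm_hasDerivWithin_le (convex_Icc a b)
          (fun x hx => (hderiv x hx).hasDerivWithinAt) fun x hx => ?_
        rw [← NNReal.coe_le_coe, coe_nnnorm]
        exact (hC x hx).trans (Real.le_coe_toNNReal C)
      rw [← huIcc] at this
      exact this.absolutelyContinuousOnInterval
    have hp := hac.integral_mul_deriv_eq_deriv_mul
      (hφ.lipschitzOnWith (s := uIcc a b)).absolutelyContinuousOnInterval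
    have e1 : ∫ x in a..b, x * F x * deriv φ x = ∫ x in a..b, x * f x * deriv φ x :=
      intervalIntegral.integral_congr fun x hx => by
        simp only [hFf x (huIcc ▸ hx)]
    rw [e1, hp, hFf b (right_mem_Icc.2 hab.le), hFf a (left_mem_Icc.2 hab.le),
      ← intervalIntegral.integral_const_mul]
    congr 1
    refine intervalIntegral.integral_congr fun x hx => ?_
    rw [huIcc] at hx
    simp only [(hderiv x hx).deriv, hFf x hx]
    ring

/-- The revenue of a utility function after integration by parts in both variables. -/
def boundaryRev (a b c d κ₁ κ₂ : ℝ) (F₁ F₂ : ℝ → ℝ) (u : ℝ × ℝ → ℝ) : ℝ :=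
  (∫ y in c..d, F₂ y * (b * F₁ b * u (b, y) - a * F₁ a * u (a, y)
    - (3 + κ₁ + κ₂) * ∫ x in a..b, F₁ x * u (x, y))) +
  ∫ x in a..b, F₁ x * (d * F₂ d * u (x, d) - c * F₂ c * u (x, c))

lemma integrableOn_of_bounded_mul {a b c d C : ℝ} {G : ℝ × ℝ → ℝ} {p : ℝ × ℝ → ℝ}
    (hG : Continuous G) (hp : Measurable p) (hC : ∀ z, ‖p z‖ ≤ C) :
    IntegrableOn (fun z => G z * p z) (Icc a b ×ˢ Icc c d) := by
  have h : IntegrableOn G (Icc a b ×ˢ Icc c d) :=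
    hG.continuousOn.integrableOn_compact (isCompact_Icc.prod isCompact_Icc)
  exact h.mul_bdd (c := C) hp.aestronglyMeasurable (Filter.Eventually.of_forall hC)

lemma integral_mul_integral_swap {a b c d : ℝ} {F₁ F₂ : ℝ → ℝ} {u : ℝ × ℝ → ℝ} (hab : a ≤ b)
    (hcd : c ≤ d) (h₁ : Continuous F₁) (h₂ : Continuous F₂) (hu : Continuous u) :
    ∫ y in c..d, F₂ y * ∫ x in a..b, F₁ x * u (x, y) =
      ∫ x in a..b, F₁ x * ∫ y in c..d, F₂ y * u (x, y) := by
  have hint : IntegrableOn (fun z : ℝ × ℝ => F₁ z.1 * F₂ z.2 * u z) (Icc a b ×ˢ Icc c d) :=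
    (by fun_prop : Continuous _).continuousOn.integrableOn_compact
      (isCompact_Icc.prod isCompact_Icc)
  rw [IntegrableOn, Measure.volume_eq_prod, ← Measure.prod_restrict] at hint
  have hswap := integral_integral_swap (f := fun x y => F₁ x * F₂ y * u (x, y)) hint
  simp only [integral_Icc_eq_integral_Ioc, ← intervalIntegral.integral_of_le hab,
    ← intervalIntegral.integral_of_le hcd, mul_assoc,
    intervalIntegral.integral_const_mul] at hswap
  rw [hswap]
  congr 1
  ext y
  rw [← intervalIntegral.integral_const_mul]
  congr 1
  ext x
  ring

lemma rev_eq_boundaryRev {a b c d κ₁ κ₂ : ℝ} {F₁ F₂ : ℝ → ℝ} (h₁ : PowerDensity a b κ₁ F₁)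
    (h₂ : PowerDensity c d κ₂ F₂) {u : ℝ × ℝ → ℝ} (hu : UnitIncr₂ u) :
    Rev a b c d F₁ F₂ u = boundaryRev a b c d κ₁ κ₂ F₁ F₂ u := by
  have hab := h₁.lt.le
  have hcd := h₂.lt.le
  have c₁ := h₁.cont
  have c₂ := h₂.cont
  have hcu : Continuous u := hu.lipschitz.continuous
  have hae : ∀ᵐ z : ℝ × ℝ, DifferentiableAt ℝ u z := hu.lipschitz.ae_differentiableAt
  have hbound : ∀ v : ℝ × ℝ, ‖v‖ ≤ 1 → ∀ z, ‖fderiv ℝ u z v‖ ≤ 2 := by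
    intro v hv z
    have h2 : ‖fderiv ℝ u z‖ ≤ 2 := norm_fderiv_le_of_lipschitz ℝ hu.lipschitz
    calc ‖fderiv ℝ u z v‖ ≤ ‖fderiv ℝ u z‖ * ‖v‖ := (fderiv ℝ u z).le_opNorm v
      _ ≤ 2 * 1 := by gcongr
      _ = 2 := by norm_num
  have i1 : IntegrableOn (fun z : ℝ × ℝ => (z.1 * F₁ z.1 * F₂ z.2) * pd1 u z)
      (Icc a b ×ˢ Icc c d) :=
    integrableOn_of_bounded_mul (by fun_prop) (measurable_fderiv_apply_const ℝ u _)
      (hbound _ (by simp [Prod.norm_def]))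
  have i2 : IntegrableOn (fun z : ℝ × ℝ => (z.2 * F₁ z.1 * F₂ z.2) * pd2 u z)
      (Icc a b ×ˢ Icc c d) :=
    integrableOn_of_bounded_mul (by fun_prop) (measurable_fderiv_apply_const ℝ u _)
      (hbound _ (by simp [Prod.norm_def]))
  have i3 : IntegrableOn (fun z : ℝ × ℝ => F₁ z.1 * F₂ z.2 * u z)
      (Icc a b ×ˢ Icc c d) :=
    (by fun_prop : Continuous _).continuousOn.integrableOn_compact
      (isCompact_Icc.prod isCompact_Icc)
  have hV : V a b c d = Icc a b ×ˢ Icc c d := by rw [V, Icc_prod_Icc]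
  have hsplit : Rev a b c d F₁ F₂ u =
      (∫ z in Icc a b ×ˢ Icc c d, (z.1 * F₁ z.1 * F₂ z.2) * pd1 u z) +
      (∫ z in Icc a b ×ˢ Icc c d, (z.2 * F₁ z.1 * F₂ z.2) * pd2 u z) -
      ∫ z in Icc a b ×ˢ Icc c d, F₁ z.1 * F₂ z.2 * u z := by
    rw [← integral_add i1 i2, ← integral_sub (by exact i1.add i2) i3, Rev, hV]
    congr 1
    ext z
    ring
  have aeyx : ∀ᵐ y : ℝ, ∀ᵐ x : ℝ, DifferentiableAt ℝ u (x, y) := by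
    rw [Measure.volume_eq_prod] at hae
    have := (Measure.measurePreserving_swap (μ := (volume : Measure ℝ))
      (ν := (volume : Measure ℝ))).quasiMeasurePreserving.ae hae
    exact Measure.ae_ae_of_ae_prod this
  have aexy : ∀ᵐ x : ℝ, ∀ᵐ y : ℝ, DifferentiableAt ℝ u (x, y) := by
    rw [Measure.volume_eq_prod] at hae
    exact Measure.ae_ae_of_ae_prod hae
  have e1 : ∫ z in Icc a b ×ˢ Icc c d, (z.1 * F₁ z.1 * F₂ z.2) * pd1 u z =
      ∫ y in c..d, F₂ y * (b * F₁ b * u (b, y) - a * F₁ a * u (a, y)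
        - (1 + κ₁) * ∫ x in a..b, F₁ x * u (x, y)) := by
    rw [IntegrableOn, Measure.volume_eq_prod, ← Measure.prod_restrict] at i1
    rw [Measure.volume_eq_prod, ← Measure.prod_restrict, integral_prod_symm _ i1,
      intervalIntegral.integral_of_le hcd, ← integral_Icc_eq_integral_Ioc]
    refine integral_congr_ae ((ae_restrict_of_ae aeyx).mono fun y hy => ?_)
    dsimp only
    rw [← h₁.parts (fun x => u (x, y)) (hu.1 y).lipschitz,
      intervalIntegral.integral_of_le hab, ← integral_Icc_eq_integral_Ioc, ← integral_const_mul]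
    refine integral_congr_ae ((ae_restrict_of_ae hy).mono fun x hx => ?_)
    have hd : HasDerivAt (fun x => u (x, y)) (pd1 u (x, y)) x :=
      hx.hasFDerivAt.comp_hasDerivAt x ((hasDerivAt_id x).prodMk (hasDerivAt_const x y))
    dsimp only
    rw [hd.deriv]
    ring
  have e2 : ∫ z in Icc a b ×ˢ Icc c d, (z.2 * F₁ z.1 * F₂ z.2) * pd2 u z =
      ∫ x in a..b, F₁ x * (d * F₂ d * u (x, d) - c * F₂ c * u (x, c)
        - (1 + κ₂) * ∫ y in c..d, F₂ y * u (x, y)) := by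
    rw [IntegrableOn, Measure.volume_eq_prod, ← Measure.prod_restrict] at i2
    rw [Measure.volume_eq_prod, ← Measure.prod_restrict, integral_prod _ i2,
      intervalIntegral.integral_of_le hab, ← integral_Icc_eq_integral_Ioc]
    refine integral_congr_ae ((ae_restrict_of_ae aexy).mono fun x hx => ?_)
    dsimp only
    rw [← h₂.parts (fun y => u (x, y)) (hu.2 x).lipschitz,
      intervalIntegral.integral_of_le hcd, ← integral_Icc_eq_integral_Ioc, ← integral_const_mul]
    refine integral_congr_ae ((ae_restrict_of_ae hx).mono fun y hy => ?_)
    have hd : HasDerivAt (fun y => u (x, y)) (pd2 u (x, y)) y :=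
      hy.hasFDerivAt.comp_hasDerivAt y ((hasDerivAt_const y x).prodMk (hasDerivAt_id y))
    dsimp only
    rw [hd.deriv]
    ring
  have i3' := i3
  rw [IntegrableOn, Measure.volume_eq_prod, ← Measure.prod_restrict] at i3'
  have e3 : ∫ z in Icc a b ×ˢ Icc c d, F₁ z.1 * F₂ z.2 * u z =
      ∫ y in c..d, F₂ y * ∫ x in a..b, F₁ x * u (x, y) := by
    rw [Measure.volume_eq_prod, ← Measure.prod_restrict, integral_prod_symm _ i3',
      intervalIntegral.integral_of_le hcd, ← integral_Icc_eq_integral_Ioc]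
    congr 1
    ext y
    rw [intervalIntegral.integral_of_le hab, ← integral_Icc_eq_integral_Ioc, ← integral_const_mul]
    congr 1
    ext x
    ring
  have e4 := e3.trans (integral_mul_integral_swap hab hcd c₁ c₂ hcu)
  have cx : Continuous fun y => ∫ x in a..b, F₁ x * u (x, y) :=
    intervalIntegral.continuous_parametric_intervalIntegral_of_continuous' (by fun_prop) _ _
  have cy : Continuous fun x => ∫ y in c..d, F₂ y * u (x, y) :=
    intervalIntegral.continuous_parametric_intervalIntegral_of_continuous' (by fun_prop) _ _
  have e2' : ∫ x in a..b, F₁ x * (d * F₂ d * u (x, d) - c * F₂ c * u (x, c)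
        - (1 + κ₂) * ∫ y in c..d, F₂ y * u (x, y)) =
      (∫ x in a..b, F₁ x * (d * F₂ d * u (x, d) - c * F₂ c * u (x, c))) -
        (1 + κ₂) * ∫ z in Icc a b ×ˢ Icc c d, F₁ z.1 * F₂ z.2 * u z := by
    rw [e4, ← intervalIntegral.integral_const_mul, ← intervalIntegral.integral_sub
      (Continuous.intervalIntegrable (by fun_prop) _ _)
      (Continuous.intervalIntegrable (by fun_prop) _ _)]
    congr 1
    ext x
    ring
  have e5 : boundaryRev a b c d κ₁ κ₂ F₁ F₂ u =
      (∫ y in c..d, F₂ y * (b * F₁ b * u (b, y) - a * F₁ a * u (a, y)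
        - (1 + κ₁) * ∫ x in a..b, F₁ x * u (x, y))) -
      (2 + κ₂) * (∫ y in c..d, F₂ y * ∫ x in a..b, F₁ x * u (x, y)) +
      ∫ x in a..b, F₁ x * (d * F₂ d * u (x, d) - c * F₂ c * u (x, c)) := by
    rw [boundaryRev, ← intervalIntegral.integral_const_mul, ← intervalIntegral.integral_sub
      (Continuous.intervalIntegrable (by fun_prop) _ _)
      (Continuous.intervalIntegrable (by fun_prop) _ _)]
    congr 2
    ext y
    ring
  rw [hsplit, e1, e2, e2', e5, e3]
  ring

lemma ConvexOn.exists_chord_left {a b s : ℝ} {g : ℝ → ℝ} (hg : UnitIncr g)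
    (hc : ConvexOn ℝ (Icc a b) g) (hs : s ∈ Icc a b) :
    ∃ m ∈ Icc (0 : ℝ) 1, g s = g a + m * (s - a) ∧
      (∀ y ∈ Icc a s, g y ≤ g a + m * (y - a)) ∧ ∀ y ∈ Icc s b, g a + m * (y - a) ≤ g y := by
  obtain ⟨has, hsb⟩ := hs
  rcases has.eq_or_lt with rfl | has
  · refine ⟨0, ⟨le_rfl, zero_le_one⟩, by ring, fun y hy => ?_, fun y hy => ?_⟩
    · rw [le_antisymm hy.2 hy.1]; linarith
    · linarith [(hg _ _ hy.1).1]
  · have hpos : 0 < s - a := by linarith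
    have hinc := hg a s has.le
    refine ⟨(g s - g a) / (s - a), ⟨div_nonneg hinc.1 hpos.le, (div_le_one hpos).2 hinc.2⟩,
      by field_simp; ring, fun y hy => ?_, fun y hy => ?_⟩
    · rcases hy.1.eq_or_lt with rfl | hay
      · simp
      · have := hc.secant_mono (a := a) (x := y) (y := s) ⟨le_rfl, has.le.trans hsb⟩
          ⟨hy.1, hy.2.trans hsb⟩ ⟨has.le, hsb⟩ hay.ne' has.ne' hy.2
        rw [div_le_iff₀ (by linarith)] at this
        linarith
    · have hay : a < y := has.trans_le hy.1
      have := hc.secant_mono (a := a) (x := s) (y := y) ⟨le_rfl, has.le.trans hsb⟩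
          ⟨has.le, hsb⟩ ⟨hay.le, hy.2⟩ has.ne' hay.ne' hy.1
      rw [le_div_iff₀ (by linarith)] at this
      linarith

lemma ConvexOn.exists_chord_right {a b s : ℝ} {g : ℝ → ℝ} (hg : UnitIncr g)
    (hc : ConvexOn ℝ (Icc a b) g) (hs : s ∈ Icc a b) :
    ∃ m ∈ Icc (0 : ℝ) 1, g s = g b + m * (s - b) ∧
      (∀ y ∈ Icc a s, g b + m * (y - b) ≤ g y) ∧ ∀ y ∈ Icc s b, g y ≤ g b + m * (y - b) := by
  obtain ⟨has, hsb⟩ := hs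
  rcases hsb.eq_or_lt with rfl | hsb
  · refine ⟨1, ⟨zero_le_one, le_rfl⟩, by ring, fun y hy => ?_, fun y hy => ?_⟩
    · linarith [(hg _ _ hy.2).2]
    · rw [le_antisymm hy.2 hy.1]; linarith
  · have hpos : 0 < b - s := by linarith
    have hinc := hg s b hsb.le
    refine ⟨(g s - g b) / (s - b), ⟨div_nonneg_of_nonpos (by linarith) (by linarith),
      (div_le_one_of_neg (by linarith)).2 (by linarith)⟩,
      ?_, fun y hy => ?_, fun y hy => ?_⟩
    · have : s - b ≠ 0 := by linarith
      field_simp; ring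
    · have hyb : y < b := hy.2.trans_lt hsb
      have := hc.secant_mono (a := b) (x := y) (y := s) ⟨has.trans hsb.le, le_rfl⟩
          ⟨hy.1, hyb.le⟩ ⟨has, hsb.le⟩ hyb.ne hsb.ne hy.2
      rw [div_le_iff_of_neg (by linarith)] at this
      linarith
    · rcases hy.2.eq_or_lt with rfl | hyb
      · simp
      · have := hc.secant_mono (a := b) (x := s) (y := y) ⟨has.trans hsb.le, le_rfl⟩
          ⟨has, hsb.le⟩ ⟨has.trans hy.1, hy.2⟩ hsb.ne hyb.ne hy.1
        rw [le_div_iff_of_neg (by linarith)] at this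
        linarith

lemma exists_crossing {a b p : ℝ} {k : ℝ → ℝ} (hab : a ≤ b) (hk : ContinuousOn k (Icc a b)) :
    ∃ s ∈ Icc a b, (s = a ∨ k s ≤ p) ∧ (s = b ∨ p ≤ k s) := by
  by_cases ha : p ≤ k a
  · exact ⟨a, ⟨le_rfl, hab⟩, Or.inl rfl, Or.inr ha⟩
  by_cases hb : k b ≤ p
  · exact ⟨b, ⟨hab, le_rfl⟩, Or.inr hb, Or.inl rfl⟩
  obtain ⟨s, hs, hsp⟩ := intermediate_value_Icc hab hk ⟨(not_le.1 ha).le, (not_le.1 hb).le⟩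
  exact ⟨s, hs, Or.inr hsp.le, Or.inr hsp.ge⟩

/-- A convex function can be replaced by a maximum of two affine functions with the same values at
the end points that is pointwise closer to a given function of the form `max p (y + q)`. -/
lemma exists_max_affine_between {a b : ℝ} {g : ℝ → ℝ} (hab : a ≤ b) (hg : UnitIncr g)
    (hc : ConvexOn ℝ (Icc a b) g) (p q : ℝ) :
    ∃ m ∈ Icc (0 : ℝ) 1, ∃ n ∈ Icc (0 : ℝ) 1,
      g a + m * (b - a) ≤ g b ∧ g b + n * (a - b) ≤ g a ∧
      ∀ y ∈ Icc a b,
        (g y ≤ max (g a + m * (y - a)) (g b + n * (y - b)) ∧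
          max (g a + m * (y - a)) (g b + n * (y - b)) ≤ max p (y + q)) ∨
        (max p (y + q) ≤ max (g a + m * (y - a)) (g b + n * (y - b)) ∧
          max (g a + m * (y - a)) (g b + n * (y - b)) ≤ g y) := by
  have hcont := hg.lipschitz.continuous
  obtain ⟨s, hs, hs1, hs2⟩ := exists_crossing (p := p) hab hcont.continuousOn
  obtain ⟨t, ht, htb, hta⟩ : ∃ t ∈ Icc s b, (t = b ∨ g t ≤ t + q) ∧ (t = s ∨ t + q ≤ g t) := by
    by_cases hsq : g s ≤ s + q
    · exact ⟨s, ⟨le_rfl, hs.2⟩, Or.inr hsq, Or.inl rfl⟩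
    by_cases hbq : b + q ≤ g b
    · exact ⟨b, ⟨hs.2, le_rfl⟩, Or.inl rfl, Or.inr hbq⟩
    obtain ⟨t, ht, htq⟩ := intermediate_value_Icc' (f := fun y => g y - y) hs.2 (by fun_prop)
      (show q ∈ Icc (g b - b) (g s - s) from ⟨by linarith, by linarith⟩)
    simp only at htq
    exact ⟨t, ht, Or.inr (by linarith), Or.inr (by linarith)⟩
  obtain ⟨m, hm, hms, hm1, hm2⟩ := hc.exists_chord_left hg hs
  have ht' : t ∈ Icc a b := ⟨hs.1.trans ht.1, ht.2⟩
  obtain ⟨n, hn, hnt, hn1, hn2⟩ := hc.exists_chord_right hg ht'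
  refine ⟨m, hm, n, hn, hm2 b ⟨hs.2, le_rfl⟩, hn1 a ⟨le_rfl, ht'.1⟩, fun y hy => ?_⟩
  have htriv : max (g a + m * (y - a)) (g b + n * (y - b)) = g y →
      (g y ≤ max (g a + m * (y - a)) (g b + n * (y - b)) ∧
        max (g a + m * (y - a)) (g b + n * (y - b)) ≤ max p (y + q)) ∨
      (max p (y + q) ≤ max (g a + m * (y - a)) (g b + n * (y - b)) ∧
        max (g a + m * (y - a)) (g b + n * (y - b)) ≤ g y) := by
    intro h
    rw [h]
    rcases le_total (g y) (max p (y + q)) with h | h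
    · exact Or.inl ⟨le_rfl, h⟩
    · exact Or.inr ⟨h, le_rfl⟩
  rcases le_total y s with hys | hys
  · have h1 := hm1 y ⟨hy.1, hys⟩
    have h2 := hn1 y ⟨hy.1, hys.trans ht.1⟩
    have hG : max (g a + m * (y - a)) (g b + n * (y - b)) = g a + m * (y - a) :=
      max_eq_left (h2.trans h1)
    rcases hs1 with rfl | hsp
    · have : y = s := le_antisymm hys hy.1
      subst this
      exact htriv (by rw [hG]; ring)
    · refine Or.inl ⟨by rw [hG]; exact h1, hG.le.trans (le_trans ?_ (le_max_left _ _))⟩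
      nlinarith [mul_nonneg hm.1 (sub_nonneg.2 hys)]
  rcases le_total t y with hty | hty
  · have h1 := hm2 y ⟨hys, hy.2⟩
    have h2 := hn2 y ⟨hty, hy.2⟩
    have hG : max (g a + m * (y - a)) (g b + n * (y - b)) = g b + n * (y - b) :=
      max_eq_right (h1.trans h2)
    rcases htb with rfl | htq
    · have : y = t := le_antisymm hy.2 hty
      subst this
      exact htriv (by rw [hG]; ring)
    · refine Or.inl ⟨by rw [hG]; exact h2, hG.le.trans (le_trans ?_ (le_max_right _ _))⟩
      nlinarith [mul_nonneg (sub_nonneg.2 hn.2) (sub_nonneg.2 hty)]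
  · have h1 := hm2 y ⟨hys, hy.2⟩
    have h2 := hn1 y ⟨hy.1, hty⟩
    rcases hs2 with rfl | hsp
    · have : y = s := le_antisymm hy.2 hys
      subst this
      exact htriv ((max_eq_left (h2.trans hms.le)).trans hms.symm)
    rcases hta with rfl | htq
    · have : y = t := le_antisymm hty hys
      subst this
      exact htriv ((max_eq_left (h2.trans hms.le)).trans hms.symm)
    · refine Or.inr ⟨max_le_max ?_ ?_, max_le h1 h2⟩
      · nlinarith [mul_nonneg hm.1 (sub_nonneg.2 hys)]
      · nlinarith [mul_nonneg (sub_nonneg.2 hn.2) (sub_nonneg.2 hty)]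

/-- Revenue collected on a horizontal slice as a function of the utility `γ` at its right end, when
the utility on the slice is the smallest one above `k` compatible with `γ`. -/
def sliceRev (a b δ : ℝ) (F k : ℝ → ℝ) (γ : ℝ) : ℝ :=
  b * F b * γ - a * F a * max (γ + a - b) (k a) - δ * ∫ x in a..b, F x * max (γ + x - b) (k x)

lemma PowerDensity.left_mul_nonneg {a b κ : ℝ} {F : ℝ → ℝ} (hF : PowerDensity a b κ F) :
    0 ≤ a * F a := mul_nonneg hF.nonneg_left (hF.nonneg a)

lemma sliceRev_mono_of_nonneg {a b κ δ γ γ' : ℝ} {F k : ℝ → ℝ} (hF : PowerDensity a b κ F)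
    (hδ : 0 ≤ δ) (hk : UnitIncr k) (h : 0 ≤ b * F b - a * F a - δ) (hγ : γ ≤ γ') :
    sliceRev a b δ F k γ ≤ sliceRev a b δ F k γ' := by
  have cF := hF.cont
  have ck := hk.lipschitz.continuous
  have key : ∀ x, max (γ' + x - b) (k x) ≤ (γ' - γ) + max (γ + x - b) (k x) := fun x =>
    max_le (by linarith [le_max_left (γ + x - b) (k x)])
      (by linarith [le_max_right (γ + x - b) (k x)])
  have hI : ∫ x in a..b, F x * max (γ' + x - b) (k x) ≤
      (γ' - γ) + ∫ x in a..b, F x * max (γ + x - b) (k x) := by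
    calc ∫ x in a..b, F x * max (γ' + x - b) (k x)
        ≤ ∫ x in a..b, (F x * (γ' - γ) + F x * max (γ + x - b) (k x)) := by
          refine intervalIntegral.integral_mono_on hF.lt.le
            (Continuous.intervalIntegrable (by fun_prop) _ _)
            (Continuous.intervalIntegrable (by fun_prop) _ _) fun x _ => ?_
          rw [← mul_add]
          exact mul_le_mul_of_nonneg_left (key x) (hF.nonneg x)
      _ = _ := by
          rw [intervalIntegral.integral_add (Continuous.intervalIntegrable (by fun_prop) _ _)
            (Continuous.intervalIntegrable (by fun_prop) _ _),
            intervalIntegral.integral_mul_const, hF.integral_eq_one, one_mul]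
  have h1 := mul_le_mul_of_nonneg_left hI hδ
  have h2 := mul_le_mul_of_nonneg_left (key a) hF.left_mul_nonneg
  have h3 := mul_nonneg h (sub_nonneg.2 hγ)
  rw [sliceRev, sliceRev]
  linarith

lemma sliceRev_mono {a b κ δ γ γ' s : ℝ} {F k : ℝ → ℝ} (hF : PowerDensity a b κ F)
    (hδ : 0 ≤ δ) (hk : UnitIncr k) (hs : s ∈ Icc a b) (h : 0 ≤ b * F b - δ * ∫ x in s..b, F x)
    (hγ : γ ≤ γ') (hγ' : γ' ≤ k s + b - s) :
    sliceRev a b δ F k γ ≤ sliceRev a b δ F k γ' := by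
  have cF := hF.cont
  have ck := hk.lipschitz.continuous
  have ii : ∀ G : ℝ → ℝ, Continuous G → ∀ p q, IntervalIntegrable G volume p q :=
    fun G hG p q => hG.intervalIntegrable p q
  have key : ∀ x, max (γ' + x - b) (k x) ≤ (γ' - γ) + max (γ + x - b) (k x) := fun x =>
    max_le (by linarith [le_max_left (γ + x - b) (k x)])
      (by linarith [le_max_right (γ + x - b) (k x)])
  have low : ∀ x ≤ s, max (γ' + x - b) (k x) = k x := fun x hx =>
    max_eq_right (by linarith [(hk x s hx).2])
  have hI1 : ∫ x in a..s, F x * max (γ' + x - b) (k x) ≤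
      ∫ x in a..s, F x * max (γ + x - b) (k x) := by
    refine intervalIntegral.integral_mono_on hs.1 (ii _ (by fun_prop) _ _)
      (ii _ (by fun_prop) _ _) fun x hx => ?_
    rw [low x hx.2]
    exact mul_le_mul_of_nonneg_left (le_max_right _ _) (hF.nonneg x)
  have hI2 : ∫ x in s..b, F x * max (γ' + x - b) (k x) ≤
      (∫ x in s..b, F x) * (γ' - γ) + ∫ x in s..b, F x * max (γ + x - b) (k x) := by
    rw [← intervalIntegral.integral_mul_const,
      ← intervalIntegral.integral_add (ii _ (by fun_prop) _ _) (ii _ (by fun_prop) _ _)]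
    refine intervalIntegral.integral_mono_on hs.2 (ii _ (by fun_prop) _ _)
      (ii _ (by fun_prop) _ _) fun x _ => ?_
    rw [← mul_add]
    exact mul_le_mul_of_nonneg_left (key x) (hF.nonneg x)
  have h1 := mul_le_mul_of_nonneg_left (add_le_add hI1 hI2) hδ
  have h2 : a * F a * max (γ' + a - b) (k a) ≤ a * F a * max (γ + a - b) (k a) := by
    rw [low a hs.1]
    exact mul_le_mul_of_nonneg_left (le_max_right _ _) hF.left_mul_nonneg
  have h3 := mul_nonneg h (sub_nonneg.2 hγ)
  rw [sliceRev, sliceRev,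
    ← intervalIntegral.integral_add_adjacent_intervals (b := s)
      (ii (fun x => F x * max (γ + x - b) (k x)) (by fun_prop) _ _) (ii _ (by fun_prop) _ _),
    ← intervalIntegral.integral_add_adjacent_intervals (b := s)
      (ii (fun x => F x * max (γ' + x - b) (k x)) (by fun_prop) _ _) (ii _ (by fun_prop) _ _)]
  linarith

lemma sliceRev_anti {a b κ δ γ γ' s : ℝ} {F k : ℝ → ℝ} (hF : PowerDensity a b κ F)
    (hδ : 0 ≤ δ) (hk : UnitIncr k) (hs : s ∈ Icc a b)
    (h : b * F b - δ * ∫ x in s..b, F x ≤ 0 ∨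
      s = a ∧ b * F b - a * F a - δ * ∫ x in s..b, F x ≤ 0)
    (hγ : γ' ≤ γ) (hγ' : k s + b - s ≤ γ') :
    sliceRev a b δ F k γ ≤ sliceRev a b δ F k γ' := by
  have cF := hF.cont
  have ck := hk.lipschitz.continuous
  have ii : ∀ G : ℝ → ℝ, Continuous G → ∀ p q, IntervalIntegrable G volume p q :=
    fun G hG p q => hG.intervalIntegrable p q
  have mono : ∀ x, max (γ' + x - b) (k x) ≤ max (γ + x - b) (k x) := fun x =>
    max_le_max (by linarith) le_rfl
  have high : ∀ x, s ≤ x → ∀ η, γ' ≤ η → max (η + x - b) (k x) = η + x - b := fun x hx η hη =>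
    max_eq_left (by linarith [(hk s x hx).2])
  have hI1 : ∫ x in a..s, F x * max (γ' + x - b) (k x) ≤
      ∫ x in a..s, F x * max (γ + x - b) (k x) :=
    intervalIntegral.integral_mono_on hs.1 (ii _ (by fun_prop) _ _)
      (ii _ (by fun_prop) _ _) fun x _ => mul_le_mul_of_nonneg_left (mono x) (hF.nonneg x)
  have hI2 : ∫ x in s..b, F x * max (γ + x - b) (k x) =
      (∫ x in s..b, F x) * (γ - γ') + ∫ x in s..b, F x * max (γ' + x - b) (k x) := by
    rw [← intervalIntegral.integral_mul_const,
      ← intervalIntegral.integral_add (ii _ (by fun_prop) _ _) (ii _ (by fun_prop) _ _)]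
    refine intervalIntegral.integral_congr fun x hx => ?_
    rw [uIcc_of_le hs.2] at hx
    simp only [high x hx.1 γ hγ, high x hx.1 γ' le_rfl]
    ring
  have h1 := mul_le_mul_of_nonneg_left hI1 hδ
  have h2 := mul_le_mul_of_nonneg_left (mono a) hF.left_mul_nonneg
  rw [sliceRev, sliceRev,
    ← intervalIntegral.integral_add_adjacent_intervals (b := s)
      (ii (fun x => F x * max (γ + x - b) (k x)) (by fun_prop) _ _) (ii _ (by fun_prop) _ _),
    ← intervalIntegral.integral_add_adjacent_intervals (b := s)
      (ii (fun x => F x * max (γ' + x - b) (k x)) (by fun_prop) _ _) (ii _ (by fun_prop) _ _), hI2]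
  rcases h with h | ⟨rfl, h⟩
  · have h3 := mul_nonpos_of_nonpos_of_nonneg h (sub_nonneg.2 hγ)
    linarith
  · have h3 := mul_nonpos_of_nonpos_of_nonneg h (sub_nonneg.2 hγ)
    rw [high s le_rfl γ hγ, high s le_rfl γ' le_rfl]
    linarith

/-- The best right-end utility for the slices lying below a top edge `h` is the maximum of a
constant and a function of slope one. -/
lemma exists_sliceRev_target {a b κ δ : ℝ} {F h : ℝ → ℝ} (hF : PowerDensity a b κ F)
    (hδ : 0 ≤ δ) (hh : UnitIncr h) (d B : ℝ) :
    ∃ p q : ℝ, ∀ y ≤ d, ∀ γ γ', γ ≤ B →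
      (γ ≤ γ' ∧ γ' ≤ max p (y + q)) ∨ (max p (y + q) ≤ γ' ∧ γ' ≤ γ) →
      sliceRev a b δ F (fun x => max 0 (h x + y - d)) γ ≤
        sliceRev a b δ F (fun x => max 0 (h x + y - d)) γ' := by
  have hk : ∀ y, UnitIncr fun x => max 0 (h x + y - d) := fun y s t hst => by
    have := hh s t hst
    rcases max_cases 0 (h s + y - d) with h1 | h1 <;>
      rcases max_cases 0 (h t + y - d) with h2 | h2 <;>
      constructor <;> linarith
  by_cases h0 : 0 ≤ b * F b - a * F a - δ
  · refine ⟨B, B - d, fun y hy γ γ' hγ H => ?_⟩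
    have hγγ : γ ≤ γ' := by
      rcases H with H | H
      · exact H.1
      · exact hγ.trans ((le_max_left _ _).trans H.1)
    exact sliceRev_mono_of_nonneg hF hδ (hk y) h0 hγγ
  have hcont : Continuous fun s => b * F b - δ * ∫ x in s..b, F x := by
    have : (fun s => b * F b - δ * ∫ x in s..b, F x) =
        fun s => b * F b + δ * ∫ x in b..s, F x := by
      ext s
      rw [intervalIntegral.integral_symm]
      ring
    rw [this]
    exact continuous_const.add (continuous_const.mul
      (intervalIntegral.continuous_primitive (fun p q => hF.cont.intervalIntegrable p q) b))
  obtain ⟨s, hs, hpos, hneg⟩ : ∃ s ∈ Icc a b, 0 ≤ b * F b - δ * ∫ x in s..b, F x ∧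
      (b * F b - δ * ∫ x in s..b, F x ≤ 0 ∨
        s = a ∧ b * F b - a * F a - δ * ∫ x in s..b, F x ≤ 0) := by
    have hb : 0 ≤ b * F b := mul_nonneg (hF.nonneg_left.trans hF.lt.le) (hF.nonneg b)
    by_cases ha : 0 ≤ b * F b - δ * ∫ x in a..b, F x
    · refine ⟨a, ⟨le_rfl, hF.lt.le⟩, ha, Or.inr ⟨rfl, ?_⟩⟩
      rw [hF.integral_eq_one]
      linarith
    · obtain ⟨s, hs, hs0⟩ := intermediate_value_Icc hF.lt.le hcont.continuousOn
        (show (0 : ℝ) ∈ Icc _ _ from ⟨(not_le.1 ha).le, by simpa using hb⟩)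
      exact ⟨s, hs, hs0.ge, Or.inl hs0.le⟩
  refine ⟨b - s, h s - d + b - s, fun y _ γ γ' _ H => ?_⟩
  have hτ : max (b - s) (y + (h s - d + b - s)) = max 0 (h s + y - d) + b - s := by
    rw [add_sub_assoc (max _ _), ← max_add_add_right]
    congr 1 <;> ring
  rw [hτ] at H
  rcases H with H | H
  · exact sliceRev_mono hF hδ (hk y) hs hpos H.1 H.2
  · exact sliceRev_anti hF hδ (hk y) hs hneg H.2 H.1

/-- The smallest utility function with right edge `g` and top edge `h`. -/
def edgeUtil (b d : ℝ) (g h : ℝ → ℝ) (z : ℝ × ℝ) : ℝ :=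
  max (g z.2 + z.1 - b) (max 0 (h z.1 + z.2 - d))

lemma boundaryRev_swap {a b c d κ₁ κ₂ : ℝ} {F₁ F₂ : ℝ → ℝ} {u : ℝ × ℝ → ℝ}
    (h₁ : PowerDensity a b κ₁ F₁) (h₂ : PowerDensity c d κ₂ F₂) (hu : Continuous u) :
    boundaryRev c d a b κ₂ κ₁ F₂ F₁ (u ∘ Prod.swap) = boundaryRev a b c d κ₁ κ₂ F₁ F₂ u := by
  have c₁ := h₁.cont
  have c₂ := h₂.cont
  have cx : Continuous fun y => ∫ x in a..b, F₁ x * u (x, y) :=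
    intervalIntegral.continuous_parametric_intervalIntegral_of_continuous' (by fun_prop) _ _
  have cy : Continuous fun x => ∫ y in c..d, F₂ y * u (x, y) :=
    intervalIntegral.continuous_parametric_intervalIntegral_of_continuous' (by fun_prop) _ _
  have ii : ∀ G : ℝ → ℝ, Continuous G → ∀ p q, IntervalIntegrable G volume p q :=
    fun G hG p q => hG.intervalIntegrable p q
  have e1 : boundaryRev a b c d κ₁ κ₂ F₁ F₂ u =
      (∫ y in c..d, F₂ y * (b * F₁ b * u (b, y) - a * F₁ a * u (a, y))) -
      (3 + κ₁ + κ₂) * (∫ y in c..d, F₂ y * ∫ x in a..b, F₁ x * u (x, y)) +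
      ∫ x in a..b, F₁ x * (d * F₂ d * u (x, d) - c * F₂ c * u (x, c)) := by
    rw [boundaryRev, ← intervalIntegral.integral_const_mul, ← intervalIntegral.integral_sub
      (ii _ (by fun_prop) _ _) (ii _ (by fun_prop) _ _)]
    congr 2
    ext y
    ring
  have e2 : boundaryRev c d a b κ₂ κ₁ F₂ F₁ (u ∘ Prod.swap) =
      (∫ x in a..b, F₁ x * (d * F₂ d * u (x, d) - c * F₂ c * u (x, c))) -
      (3 + κ₁ + κ₂) * (∫ x in a..b, F₁ x * ∫ y in c..d, F₂ y * u (x, y)) +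
      ∫ y in c..d, F₂ y * (b * F₁ b * u (b, y) - a * F₁ a * u (a, y)) := by
    rw [boundaryRev, ← intervalIntegral.integral_const_mul, ← intervalIntegral.integral_sub
      (ii _ (by fun_prop) _ _) (ii _ (by fun_prop) _ _)]
    simp only [Function.comp_apply, Prod.swap_prod_mk]
    congr 2
    ext x
    ring
  rw [e1, e2, integral_mul_integral_swap h₁.lt.le h₂.lt.le c₁ c₂ hu]
  ring

lemma edgeUtil_swap (b d : ℝ) (g h : ℝ → ℝ) {z : ℝ × ℝ} :
    edgeUtil b d g h z.swap = edgeUtil d b h g z := by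
  simp only [edgeUtil, Prod.fst_swap, Prod.snd_swap]
  ac_rfl

lemma continuous_edgeUtil {b d : ℝ} {g h : ℝ → ℝ} (hg : Continuous g) (hh : Continuous h) :
    Continuous (edgeUtil b d g h) := by
  unfold edgeUtil
  fun_prop

lemma edgeUtil_right {b d : ℝ} {g h : ℝ → ℝ} (hg : UnitIncr g) (hgh : h b = g d) {y : ℝ}
    (hy : y ≤ d) (h0 : 0 ≤ g y) : edgeUtil b d g h (b, y) = g y := by
  have := hg y d hy
  rw [edgeUtil, max_eq_left (max_le _ _)] <;> simp only <;> linarith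

lemma edgeUtil_top {b d : ℝ} {g h : ℝ → ℝ} (hh : UnitIncr h) (hgh : h b = g d) {x : ℝ}
    (hx : x ≤ b) (h0 : 0 ≤ h x) : edgeUtil b d g h (x, d) = h x := by
  have := hh x b hx
  rw [edgeUtil, max_eq_right (le_max_of_le_right _), max_eq_right] <;> simp only <;> linarith

/-- Replacing a utility function by the smallest one with the same right and top edges does not
decrease revenue. -/
lemma boundaryRev_le_edgeUtil {a b c d κ₁ κ₂ : ℝ} {F₁ F₂ : ℝ → ℝ} {u : ℝ × ℝ → ℝ}
    (h₁ : PowerDensity a b κ₁ F₁) (h₂ : PowerDensity c d κ₂ F₂) (hδ : 0 ≤ 3 + κ₁ + κ₂)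
    (hu : UnitIncr₂ u) (h0 : ∀ x ∈ Icc a b, ∀ y ∈ Icc c d, 0 ≤ u (x, y)) :
    boundaryRev a b c d κ₁ κ₂ F₁ F₂ u ≤ boundaryRev a b c d κ₁ κ₂ F₁ F₂
      (edgeUtil b d (fun y => u (b, y)) fun x => u (x, d)) := by
  have hab := h₁.lt.le
  have hcd := h₂.lt.le
  have c₁ := h₁.cont
  have c₂ := h₂.cont
  have cu : Continuous u := hu.lipschitz.continuous
  set v := edgeUtil b d (fun y => u (b, y)) fun x => u (x, d) with hv
  have cv : Continuous v := continuous_edgeUtil (by fun_prop) (by fun_prop)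
  have hle : ∀ x ∈ Icc a b, ∀ y ∈ Icc c d, v (x, y) ≤ u (x, y) := fun x hx y hy => by
    have e1 := hu.1 y x b hx.2
    have e2 := hu.2 x y d hy.2
    refine max_le ?_ (max_le (h0 x hx y hy) ?_) <;> simp only at * <;> linarith
  have hr : ∀ y ∈ Icc c d, v (b, y) = u (b, y) := fun y hy =>
    edgeUtil_right (g := fun y => u (b, y)) (hu.2 b) rfl hy.2 (h0 b ⟨hab, le_rfl⟩ y hy)
  have ht : ∀ x ∈ Icc a b, v (x, d) = u (x, d) := fun x hx =>
    edgeUtil_top (h := fun x => u (x, d)) (hu.1 d) rfl hx.2 (h0 x hx d ⟨hcd, le_rfl⟩)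
  have cx : ∀ w : ℝ × ℝ → ℝ, Continuous w → Continuous fun y => ∫ x in a..b, F₁ x * w (x, y) :=
    fun w hw =>
      intervalIntegral.continuous_parametric_intervalIntegral_of_continuous' (by fun_prop) _ _
  have cxu := cx u cu
  have cxv := cx v cv
  refine add_le_add ?_ ?_
  · refine intervalIntegral.integral_mono_on hcd (Continuous.intervalIntegrable (by fun_prop) _ _)
      (Continuous.intervalIntegrable (by fun_prop) _ _) fun y hy => ?_
    refine mul_le_mul_of_nonneg_left ?_ (h₂.nonneg y)
    have e1 : ∫ x in a..b, F₁ x * v (x, y) ≤ ∫ x in a..b, F₁ x * u (x, y) :=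
      intervalIntegral.integral_mono_on hab (Continuous.intervalIntegrable (by fun_prop) _ _)
        (Continuous.intervalIntegrable (by fun_prop) _ _) fun x hx =>
          mul_le_mul_of_nonneg_left (hle x hx y hy) (h₁.nonneg x)
    have e2 := mul_le_mul_of_nonneg_left e1 hδ
    have e3 := mul_le_mul_of_nonneg_left (hle a ⟨le_rfl, hab⟩ y hy) h₁.left_mul_nonneg
    rw [hr y hy]
    linarith
  · refine intervalIntegral.integral_mono_on hab (Continuous.intervalIntegrable (by fun_prop) _ _)
      (Continuous.intervalIntegrable (by fun_prop) _ _) fun x hx => ?_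
    refine mul_le_mul_of_nonneg_left ?_ (h₁.nonneg x)
    have e3 := mul_le_mul_of_nonneg_left (hle x hx c ⟨le_rfl, hcd⟩) h₂.left_mul_nonneg
    rw [ht x hx]
    linarith

/-- The maximum of the affine function of slope `m` through `(a, α)` and the affine function of
slope `n` through `(b, β)`. -/
def maxAffine (a b α m n β : ℝ) (y : ℝ) : ℝ := max (α + m * (y - a)) (β + n * (y - b))

lemma unitIncr_maxAffine {a b α m n β : ℝ} (hm : m ∈ Icc (0 : ℝ) 1) (hn : n ∈ Icc (0 : ℝ) 1) :
    UnitIncr (maxAffine a b α m n β) := by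
  intro s t hst
  have m1 := mul_nonneg hm.1 (sub_nonneg.2 hst)
  have m2 := mul_nonneg (sub_nonneg.2 hm.2) (sub_nonneg.2 hst)
  have n1 := mul_nonneg hn.1 (sub_nonneg.2 hst)
  have n2 := mul_nonneg (sub_nonneg.2 hn.2) (sub_nonneg.2 hst)
  unfold maxAffine
  rcases max_cases (α + m * (s - a)) (β + n * (s - b)) with h1 | h1 <;>
      rcases max_cases (α + m * (t - a)) (β + n * (t - b)) with h2 | h2 <;>
      constructor <;> linarith

lemma maxAffine_left {a b α m n β : ℝ} (h : β + n * (a - b) ≤ α) :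
    maxAffine a b α m n β a = α := by
  rw [maxAffine, sub_self, mul_zero, add_zero, max_eq_left h]

lemma maxAffine_right {a b α m n β : ℝ} (h : α + m * (b - a) ≤ β) :
    maxAffine a b α m n β b = β := by
  rw [maxAffine, sub_self, mul_zero, add_zero, max_eq_right h]

lemma maxAffine_nonneg {a b α m n β y : ℝ} (hα : 0 ≤ α) (hm : m ∈ Icc (0 : ℝ) 1) (hy : a ≤ y) :
    0 ≤ maxAffine a b α m n β y :=
  le_max_of_le_left (add_nonneg hα (mul_nonneg hm.1 (sub_nonneg.2 hy)))

lemma maxAffine_two_pieces {a b α m n β : ℝ} (hab : a < b) (h : α + m * (b - a) ≤ β) :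
    ∃ e ∈ Icc a b, (∃ r k, ∀ y ∈ Icc a e, maxAffine a b α m n β y = r * y + k) ∧
      ∃ r k, ∀ y ∈ Icc e b, maxAffine a b α m n β y = r * y + k := by
  have key : ∀ y y', y ≤ y' → m ≤ n → m * (y' - y) ≤ n * (y' - y) := fun y y' hy hmn =>
    mul_le_mul_of_nonneg_right hmn (sub_nonneg.2 hy)
  by_cases ha : β + n * (a - b) ≤ α
  · have hmn : m ≤ n := by nlinarith
    obtain ⟨e, he, he0⟩ := intermediate_value_Icc' hab.le
      (f := fun y => (α + m * (y - a)) - (β + n * (y - b))) (by fun_prop)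
      (show (0 : ℝ) ∈ Icc _ _ from ⟨by linarith, by linarith⟩)
    simp only at he0
    refine ⟨e, he, ⟨m, α - m * a, fun y hy => ?_⟩, n, β - n * b, fun y hy => ?_⟩
    · rw [maxAffine, max_eq_left (by linarith [key y e hy.2 hmn])]
      ring
    · rw [maxAffine, max_eq_right (by linarith [key e y hy.1 hmn])]
      ring
  · have hall : ∀ y ∈ Icc a b, maxAffine a b α m n β y = n * y + (β - n * b) := fun y hy => by
      rw [maxAffine, max_eq_right]
      · ring
      · nlinarith [hy.1, hy.2]
    exact ⟨b, ⟨hab.le, le_rfl⟩, ⟨n, _, hall⟩, n, _, fun y hy => hall y ⟨hab.le.trans hy.1, hy.2⟩⟩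

/-- The right edge can be replaced by a maximum of two affine functions. -/
lemma exists_right_edge {a b c d κ₁ κ₂ : ℝ} {F₁ F₂ g h : ℝ → ℝ}
    (h₁ : PowerDensity a b κ₁ F₁) (h₂ : PowerDensity c d κ₂ F₂) (hδ : 0 ≤ 3 + κ₁ + κ₂)
    (hg : UnitIncr g) (hgc : ConvexOn ℝ (Icc c d) g) (hh : UnitIncr h) (hgh : h b = g d)
    (h0 : 0 ≤ g c) :
    ∃ m ∈ Icc (0 : ℝ) 1, ∃ n ∈ Icc (0 : ℝ) 1, g c + m * (d - c) ≤ g d ∧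
      boundaryRev a b c d κ₁ κ₂ F₁ F₂ (edgeUtil b d g h) ≤
        boundaryRev a b c d κ₁ κ₂ F₁ F₂ (edgeUtil b d (maxAffine c d (g c) m n (g d)) h) := by
  have hab := h₁.lt.le
  have hcd := h₂.lt.le
  have c₁ := h₁.cont
  have c₂ := h₂.cont
  obtain ⟨p, q, hpq⟩ := exists_sliceRev_target h₁ hδ hh d (g d)
  obtain ⟨m, hm, n, hn, hmd, hnc, hbtw⟩ := exists_max_affine_between hcd hg hgc p q
  refine ⟨m, hm, n, hn, hmd, ?_⟩
  set G := maxAffine c d (g c) m n (g d) with hG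
  have hGu : UnitIncr G := unitIncr_maxAffine hm hn
  have hGc : G c = g c := maxAffine_left hnc
  have hGd : G d = g d := maxAffine_right hmd
  have slice : ∀ k : ℝ → ℝ, UnitIncr k → h b = k d → 0 ≤ k c → ∀ y ∈ Icc c d,
      b * F₁ b * edgeUtil b d k h (b, y) - a * F₁ a * edgeUtil b d k h (a, y)
        - (3 + κ₁ + κ₂) * ∫ x in a..b, F₁ x * edgeUtil b d k h (x, y) =
      sliceRev a b (3 + κ₁ + κ₂) F₁ (fun x => max 0 (h x + y - d)) (k y) := by
    intro k hk hkb hkc y hy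
    rw [edgeUtil_right hk hkb hy.2 (by linarith [(hk c y hy.1).1])]
    rfl
  have cg := hg.lipschitz.continuous
  have cG := hGu.lipschitz.continuous
  have ch := hh.lipschitz.continuous
  have cug : Continuous (edgeUtil b d g h) := continuous_edgeUtil cg ch
  have cuG : Continuous (edgeUtil b d G h) := continuous_edgeUtil cG ch
  have cx : ∀ w : ℝ × ℝ → ℝ, Continuous w → Continuous fun y => ∫ x in a..b, F₁ x * w (x, y) :=
    fun w hw =>
      intervalIntegral.continuous_parametric_intervalIntegral_of_continuous' (by fun_prop) _ _
  have cxg := cx _ cug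
  have cxG := cx _ cuG
  refine add_le_add ?_ (le_of_eq ?_)
  · refine intervalIntegral.integral_mono_on hcd (Continuous.intervalIntegrable (by fun_prop) _ _)
      (Continuous.intervalIntegrable (by fun_prop) _ _) fun y hy => ?_
    refine mul_le_mul_of_nonneg_left ?_ (h₂.nonneg y)
    rw [slice g hg hgh h0 y hy, slice G hGu (hgh.trans hGd.symm) (hGc ▸ h0) y hy]
    exact hpq y hy.2 _ _ (by linarith [(hg y d hy.2).1]) (hbtw y hy)
  · simp only [edgeUtil, hGc, hGd]

lemma convexOn_edgeUtil {b d : ℝ} {g h : ℝ → ℝ} (hg : ConvexOn ℝ univ g)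
    (hh : ConvexOn ℝ univ h) : ConvexOn ℝ univ (edgeUtil b d g h) := by
  have fst : ConvexOn ℝ univ fun z : ℝ × ℝ => z.1 :=
    (LinearMap.fst ℝ ℝ ℝ).convexOn convex_univ
  have snd : ConvexOn ℝ univ fun z : ℝ × ℝ => z.2 :=
    (LinearMap.snd ℝ ℝ ℝ).convexOn convex_univ
  have e1 : ConvexOn ℝ univ fun z : ℝ × ℝ => g z.2 + z.1 - b :=
    ((hg.comp_linearMap (LinearMap.snd ℝ ℝ ℝ)).add fst).sub (concaveOn_const b convex_univ)
  have e2 : ConvexOn ℝ univ fun z : ℝ × ℝ => h z.1 + z.2 - d :=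
    ((hh.comp_linearMap (LinearMap.fst ℝ ℝ ℝ)).add snd).sub (concaveOn_const d convex_univ)
  exact e1.sup ((convexOn_const 0 convex_univ).sup e2)

lemma convexOn_maxAffine (a b α m n β : ℝ) : ConvexOn ℝ univ (maxAffine a b α m n β) := by
  have aff : ∀ a α m : ℝ, ConvexOn ℝ univ fun y : ℝ => α + m * (y - a) := fun a α m =>
    ⟨convex_univ, fun x _ y _ s t _ _ hst => le_of_eq <| by
      simp only [smul_eq_mul]
      linear_combination (m * a - α) * hst⟩
  exact (aff a α m).sup (aff b β n)

lemma unitIncr₂_edgeUtil {b d : ℝ} {g h : ℝ → ℝ} (hg : UnitIncr g) (hh : UnitIncr h) :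
    UnitIncr₂ (edgeUtil b d g h) := by
  constructor
  · intro y s t hst
    have h2 := hh s t hst
    simp only [edgeUtil]
    constructor
    · exact sub_nonneg.2 (max_le_max (by linarith) (max_le_max le_rfl (by linarith)))
    · rw [sub_le_iff_le_add, ← max_add_add_left, ← max_add_add_left]
      exact max_le_max (by linarith) (max_le_max (by linarith) (by linarith))
  · intro x s t hst
    have h2 := hg s t hst
    simp only [edgeUtil]
    constructor
    · exact sub_nonneg.2 (max_le_max (by linarith) (max_le_max le_rfl (by linarith)))
    · rw [sub_le_iff_le_add, ← max_add_add_left, ← max_add_add_left]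
      exact max_le_max (by linarith) (max_le_max (by linarith) (by linarith))

lemma feasible_edgeUtil {a b c d : ℝ} {g h : ℝ → ℝ} (hg : UnitIncr g) (hh : UnitIncr h)
    (hgc : ConvexOn ℝ univ g) (hhc : ConvexOn ℝ univ h) :
    Feasible a b c d (edgeUtil b d g h) := by
  have hu := unitIncr₂_edgeUtil (b := b) (d := d) hg hh
  refine ⟨fun z _ => le_max_of_le_right (le_max_left _ _),
    (convexOn_edgeUtil hgc hhc).subset (subset_univ _) (convex_Icc _ _),
    fun x x' y _ hx _ _ => hu.1 y x x' hx, fun x y y' _ _ hy _ => hu.2 x y y' hy⟩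

lemma rev_congr_s11 {a b c d : ℝ} {f₁ f₂ F₁ F₂ : ℝ → ℝ} {u v : ℝ × ℝ → ℝ}
    (h₁ : ∀ x ∈ Icc a b, F₁ x = f₁ x) (h₂ : ∀ y ∈ Icc c d, F₂ y = f₂ y)
    (huv : ∀ z ∈ V a b c d, u z = v z) :
    Rev a b c d f₁ f₂ u = Rev a b c d F₁ F₂ v := by
  have hV : (V a b c d : Set (ℝ × ℝ)) =ᵐ[volume] (Ioo a b ×ˢ Ioo c d : Set (ℝ × ℝ)) := by
    rw [V, ← Icc_prod_Icc]
    exact Measure.set_prod_ae_eq Ioo_ae_eq_Icc.symm Ioo_ae_eq_Icc.symm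
  rw [Rev, Rev, setIntegral_congr_set hV, setIntegral_congr_set hV]
  refine setIntegral_congr_fun (measurableSet_Ioo.prod measurableSet_Ioo) fun z hz => ?_
  have hsub : (Ioo a b ×ˢ Ioo c d : Set (ℝ × ℝ)) ⊆ V a b c d := by
    rw [V, ← Icc_prod_Icc]
    exact prod_mono Ioo_subset_Icc_self Ioo_subset_Icc_self
  have hev : u =ᶠ[nhds z] v :=
    Filter.mem_of_superset ((isOpen_Ioo.prod isOpen_Ioo).mem_nhds hz) fun w hw => huv w (hsub hw)
  simp only [pd1, pd2, hev.fderiv_eq, huv z (hsub hz), h₁ _ (Ioo_subset_Icc_self hz.1),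
    h₂ _ (Ioo_subset_Icc_self hz.2)]

lemma boundaryRev_le_sub_const {a b c d κ₁ κ₂ k : ℝ} {F₁ F₂ : ℝ → ℝ} {u : ℝ × ℝ → ℝ}
    (h₁ : PowerDensity a b κ₁ F₁) (h₂ : PowerDensity c d κ₂ F₂) (hu : UnitIncr₂ u) (hk : 0 ≤ k) :
    boundaryRev a b c d κ₁ κ₂ F₁ F₂ u ≤ boundaryRev a b c d κ₁ κ₂ F₁ F₂ fun z => u z - k := by
  have c₁ := h₁.cont
  have c₂ := h₂.cont
  have cu := hu.lipschitz.continuous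
  have ii : ∀ G : ℝ → ℝ, Continuous G → ∀ p q, IntervalIntegrable G volume p q :=
    fun G hG p q => hG.intervalIntegrable p q
  have cx : Continuous fun y => ∫ x in a..b, F₁ x * u (x, y) :=
    intervalIntegral.continuous_parametric_intervalIntegral_of_continuous' (by fun_prop) _ _
  have hconst : boundaryRev a b c d κ₁ κ₂ F₁ F₂ (fun _ => k) ≤ 0 := by
    rw [← rev_eq_boundaryRev h₁ h₂ ⟨fun y s t hst => by simpa using hst,
      fun x s t hst => by simpa using hst⟩]
    refine integral_nonpos fun z => ?_
    simp only [pd1, pd2, fderiv_fun_const, Pi.zero_apply, _root_.zero_apply,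
      mul_zero, zero_add, zero_sub]
    exact mul_nonpos_of_nonpos_of_nonneg (neg_nonpos.2 hk)
      (mul_nonneg (h₁.nonneg _) (h₂.nonneg _))
  have hadd : boundaryRev a b c d κ₁ κ₂ F₁ F₂ u =
      boundaryRev a b c d κ₁ κ₂ F₁ F₂ (fun z => u z - k) +
        boundaryRev a b c d κ₁ κ₂ F₁ F₂ (fun _ => k) := by
    have inner : ∀ y, ∫ x in a..b, F₁ x * (u (x, y) - k) =
        (∫ x in a..b, F₁ x * u (x, y)) - ∫ x in a..b, F₁ x * k := fun y => by
      rw [← intervalIntegral.integral_sub (ii _ (by fun_prop) _ _) (ii _ (by fun_prop) _ _)]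
      congr 1
      ext x
      ring
    simp only [boundaryRev, inner]
    rw [add_add_add_comm, ← intervalIntegral.integral_add (ii _ (by fun_prop) _ _)
      (ii _ (by fun_prop) _ _), ← intervalIntegral.integral_add (ii _ (by fun_prop) _ _)
      (ii _ (by fun_prop) _ _)]
    congr 2 <;> ext x <;> ring
  linarith

/-- A feasible utility function extends to the plane with the same bounds on increments. -/
lemma Feasible.exists_extension {a b c d : ℝ} {u : ℝ × ℝ → ℝ} (hab : a ≤ b) (hcd : c ≤ d)
    (hu : Feasible a b c d u) :
    ∃ v : ℝ × ℝ → ℝ, UnitIncr₂ v ∧ ∀ z ∈ V a b c d, v z = u z := by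
  obtain ⟨-, -, hx, hy⟩ := hu
  have hproj : ∀ {a b : ℝ} (hab : a ≤ b), UnitIncr fun x => (projIcc a b hab x : ℝ) := by
    intro a b hab s t hst
    simp only [coe_projIcc]
    rcases max_cases a (min b s) with h1 | h1 <;> rcases max_cases a (min b t) with h2 | h2 <;>
      rcases min_cases b s with h3 | h3 <;> rcases min_cases b t with h4 | h4 <;>
      constructor <;> linarith
  refine ⟨fun z => u (projIcc a b hab z.1, projIcc c d hcd z.2), ⟨fun y s t hst => ?_,
    fun x s t hst => ?_⟩, fun z hz => ?_⟩
  · have h1 := hproj hab s t hst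
    have h2 := hx _ _ _ (projIcc a b hab s).2.1 (by linarith) (projIcc a b hab t).2.2
      (projIcc c d hcd y).2
    exact ⟨h2.1, h2.2.trans h1.2⟩
  · have h1 := hproj hcd s t hst
    have h2 := hy _ _ _ (projIcc a b hab x).2 (projIcc c d hcd s).2.1 (by linarith)
      (projIcc c d hcd t).2.2
    exact ⟨h2.1, h2.2.trans h1.2⟩
  · rw [V, ← Icc_prod_Icc] at hz
    simp only [projIcc_of_mem hab hz.1, projIcc_of_mem hcd hz.2]

/-- The utility function whose edges are maxima of two affine functions, with parameters
`((α, m, n), (α', m', n'), β)`, where `β` is the utility at the top right corner. -/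
def menuUtil (a b c d : ℝ) (θ : (ℝ × ℝ × ℝ) × (ℝ × ℝ × ℝ) × ℝ) : ℝ × ℝ → ℝ :=
  edgeUtil b d (maxAffine c d θ.1.1 θ.1.2.1 θ.1.2.2 θ.2.2)
    (maxAffine a b θ.2.1.1 θ.2.1.2.1 θ.2.1.2.2 θ.2.2)

/-- Parameters for which `menuUtil` has the prescribed edges, with corner utility at most `M`. -/
def menuParams (a b c d M : ℝ) : Set ((ℝ × ℝ × ℝ) × (ℝ × ℝ × ℝ) × ℝ) :=
  ((Icc 0 M ×ˢ Icc 0 1 ×ˢ Icc 0 1) ×ˢ (Icc 0 M ×ˢ Icc 0 1 ×ˢ Icc 0 1) ×ˢ Icc 0 M) ∩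
    {θ | θ.1.1 + θ.1.2.1 * (d - c) ≤ θ.2.2 ∧ θ.2.1.1 + θ.2.1.2.1 * (b - a) ≤ θ.2.2}

lemma isCompact_menuParams (a b c d M : ℝ) : IsCompact (menuParams a b c d M) := by
  have h : IsCompact (Icc (0 : ℝ) M ×ˢ Icc (0 : ℝ) 1 ×ˢ Icc (0 : ℝ) 1) :=
    isCompact_Icc.prod (isCompact_Icc.prod isCompact_Icc)
  refine (h.prod (h.prod isCompact_Icc)).inter_right (IsClosed.and ?_ ?_) <;>
    exact isClosed_le (by fun_prop) (by fun_prop)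

lemma continuous_boundaryRev_menuUtil {a b c d κ₁ κ₂ : ℝ} {F₁ F₂ : ℝ → ℝ} (h₁ : Continuous F₁)
    (h₂ : Continuous F₂) :
    Continuous fun θ => boundaryRev a b c d κ₁ κ₂ F₁ F₂ (menuUtil a b c d θ) := by
  have hm : Continuous fun p : ((ℝ × ℝ × ℝ) × (ℝ × ℝ × ℝ) × ℝ) × ℝ × ℝ =>
      menuUtil a b c d p.1 p.2 := by
    unfold menuUtil edgeUtil maxAffine
    fun_prop
  have hc : ∀ {X : Type} [TopologicalSpace X] (θ : X → (ℝ × ℝ × ℝ) × (ℝ × ℝ × ℝ) × ℝ)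
      (p q : X → ℝ), Continuous θ → Continuous p → Continuous q →
      Continuous fun t => menuUtil a b c d (θ t) (p t, q t) := fun θ p q hθ hp hq =>
    hm.comp (hθ.prodMk (hp.prodMk hq))
  have inner : Continuous fun p : ((ℝ × ℝ × ℝ) × (ℝ × ℝ × ℝ) × ℝ) × ℝ =>
      ∫ x in a..b, F₁ x * menuUtil a b c d p.1 (x, p.2) := by
    refine intervalIntegral.continuous_parametric_intervalIntegral_of_continuous' ?_ _ _
    exact (h₁.comp continuous_snd).mul
      (hc (fun t : (((ℝ × ℝ × ℝ) × (ℝ × ℝ × ℝ) × ℝ) × ℝ) × ℝ => t.1.1) (fun t => t.2) (fun t => t.1.2) (by fun_prop) (by fun_prop)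
        (by fun_prop))
  have e1 := fun e => hc (fun t : ((ℝ × ℝ × ℝ) × (ℝ × ℝ × ℝ) × ℝ) × ℝ => t.1) (fun _ => e)
    (fun t => t.2) (by fun_prop) (by fun_prop) (by fun_prop)
  have e2 := fun e => hc (fun t : ((ℝ × ℝ × ℝ) × (ℝ × ℝ × ℝ) × ℝ) × ℝ => t.1) (fun t => t.2)
    (fun _ => e) (by fun_prop) (by fun_prop) (by fun_prop)
  refine Continuous.add ?_ ?_ <;>
    refine intervalIntegral.continuous_parametric_intervalIntegral_of_continuous' ?_ _ _
  · exact (h₂.comp continuous_snd).mul (((continuous_const.mul (e1 b)).sub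
      (continuous_const.mul (e1 a))).sub (continuous_const.mul inner))
  · exact (h₁.comp continuous_snd).mul ((continuous_const.mul (e2 d)).sub
      (continuous_const.mul (e2 c)))

/-- The two-piece menus attain at least the revenue of any feasible utility function. -/
lemma exists_menuUtil_ge {a b c d κ₁ κ₂ : ℝ} {F₁ F₂ : ℝ → ℝ} {u : ℝ × ℝ → ℝ}
    (h₁ : PowerDensity a b κ₁ F₁) (h₂ : PowerDensity c d κ₂ F₂) (hδ : 0 ≤ 3 + κ₁ + κ₂)
    (hu : Feasible a b c d u) :
    ∃ θ ∈ menuParams a b c d (b - a + (d - c)),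
      Rev a b c d F₁ F₂ u ≤ boundaryRev a b c d κ₁ κ₂ F₁ F₂ (menuUtil a b c d θ) := by
  have hab := h₁.lt.le
  have hcd := h₂.lt.le
  obtain ⟨w, hw, hwu⟩ := hu.exists_extension hab hcd
  have memV : ∀ {x y : ℝ}, x ∈ Icc a b → y ∈ Icc c d → (x, y) ∈ V a b c d :=
    fun hx hy => ⟨⟨hx.1, hy.1⟩, hx.2, hy.2⟩
  have ma : a ∈ Icc a b := ⟨le_rfl, hab⟩
  have mb : b ∈ Icc a b := ⟨hab, le_rfl⟩
  have mc : c ∈ Icc c d := ⟨le_rfl, hcd⟩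
  have md : d ∈ Icc c d := ⟨hcd, le_rfl⟩
  have hk : 0 ≤ w (a, c) := by
    rw [hwu _ (memV ma mc)]
    exact hu.1 _ (memV ma mc)
  set v : ℝ × ℝ → ℝ := fun z => w z - w (a, c) with hv
  have hvi : UnitIncr₂ v :=
    ⟨fun y s t hst => by simpa [hv] using hw.1 y s t hst,
      fun x s t hst => by simpa [hv] using hw.2 x s t hst⟩
  have hvac : v (a, c) = 0 := sub_self _
  have hvc : ConvexOn ℝ (V a b c d) v := by
    have h : ConvexOn ℝ (V a b c d) w := hu.2.1.congr fun z hz => (hwu z hz).symm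
    exact h.sub (concaveOn_const _ h.1)
  have hv0 : ∀ x ∈ Icc a b, ∀ y ∈ Icc c d, 0 ≤ v (x, y) := fun x hx y hy => by
    have e1 := hvi.1 c a x hx.1
    have e2 := hvi.2 x c y hy.1
    simp only at e1 e2
    linarith
  have hvM : ∀ x ∈ Icc a b, ∀ y ∈ Icc c d, v (x, y) ≤ b - a + (d - c) := fun x hx y hy => by
    have e1 := hvi.1 c a x hx.1
    have e2 := hvi.2 x c y hy.1
    simp only at e1 e2
    linarith [hx.2, hy.2]
  have hgc : ConvexOn ℝ (Icc c d) fun y => v (b, y) := by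
    refine ⟨convex_Icc c d, fun x hx y hy s t hs ht hst => ?_⟩
    have := hvc.2 (memV mb hx) (memV mb hy) hs ht hst
    simpa only [Prod.smul_mk, Prod.mk_add_mk, ← add_smul, hst, one_smul] using this
  have hhc : ConvexOn ℝ (Icc a b) fun x => v (x, d) := by
    refine ⟨convex_Icc a b, fun x hx y hy s t hs ht hst => ?_⟩
    have := hvc.2 (memV hx md) (memV hy md) hs ht hst
    simpa only [Prod.smul_mk, Prod.mk_add_mk, ← add_smul, hst, one_smul] using this
  obtain ⟨m, hm, n, hn, hmd, hrev⟩ := exists_right_edge h₁ h₂ hδ (hvi.2 b) hgc (hvi.1 d) rfl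
    (hv0 b mb c mc)
  set G := maxAffine c d (v (b, c)) m n (v (b, d)) with hG
  have hGi : UnitIncr G := unitIncr_maxAffine hm hn
  obtain ⟨m', hm', n', hn', hmd', hrev'⟩ := exists_right_edge h₂ h₁ (by linarith) (hvi.1 d) hhc
    hGi (maxAffine_right hmd) (hv0 a ma d md)
  set H := maxAffine a b (v (a, d)) m' n' (v (b, d)) with hH
  have hHi : UnitIncr H := unitIncr_maxAffine hm' hn'
  have hsw : ∀ k : ℝ → ℝ, UnitIncr k →
      boundaryRev c d a b κ₂ κ₁ F₂ F₁ (edgeUtil d b k G) =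
        boundaryRev a b c d κ₁ κ₂ F₁ F₂ (edgeUtil b d G k) := fun k hki => by
    rw [← boundaryRev_swap h₁ h₂
      (continuous_edgeUtil hGi.lipschitz.continuous hki.lipschitz.continuous)]
    congr 1
    ext z
    exact (edgeUtil_swap b d G k).symm
  rw [hsw _ (hvi.1 d), hsw H hHi] at hrev'
  refine ⟨((v (b, c), m, n), (v (a, d), m', n'), v (b, d)),
    ⟨⟨⟨⟨hv0 b mb c mc, hvM b mb c mc⟩, hm, hn⟩, ⟨⟨hv0 a ma d md, hvM a ma d md⟩, hm', hn'⟩,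
      hv0 b mb d md, hvM b mb d md⟩, hmd, hmd'⟩, ?_⟩
  calc Rev a b c d F₁ F₂ u = Rev a b c d F₁ F₂ w :=
        rev_congr_s11 (fun _ _ => rfl) (fun _ _ => rfl) fun z hz => (hwu z hz).symm
    _ = boundaryRev a b c d κ₁ κ₂ F₁ F₂ w := rev_eq_boundaryRev h₁ h₂ hw
    _ ≤ boundaryRev a b c d κ₁ κ₂ F₁ F₂ v := boundaryRev_le_sub_const h₁ h₂ hw hk
    _ ≤ _ := boundaryRev_le_edgeUtil h₁ h₂ hδ hvi hv0
    _ ≤ _ := hrev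
    _ ≤ _ := hrev'

/-- under Conditions 2 and 3, some optimal feasible utility restricted to
the right edge and to the top edge of `V` is piecewise linear with at most two pieces. -/
theorem stmt11 (xA xB yA yC : ℝ) (h0 : 0 ≤ xA) (h1 : xA < xB) (h2 : 0 ≤ yA) (h3 : yA < yC)
    (f1 f2 : ℝ → ℝ) (hf1 : Density xA xB f1) (hf2 : Density yA yC f2)
    (hC2 : ∀ x ∈ Set.Icc xA xB, ∀ y ∈ Set.Icc yA yC, -3 ≤ PR f1 x + PR f2 y)
    (hC3a : ∃ c1 : ℝ, ∀ x ∈ Set.Icc xA xB, PR f1 x = c1)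
    (hC3b : ∃ c2 : ℝ, ∀ y ∈ Set.Icc yA yC, PR f2 y = c2) :
    ∃ u : ℝ × ℝ → ℝ, Optimal xA xB yA yC f1 f2 u ∧
      ∃ c ∈ Set.Icc yA yC, ∃ d ∈ Set.Icc xA xB,
        (∃ m k : ℝ, ∀ y ∈ Set.Icc yA c, u (xB, y) = m * y + k) ∧
        (∃ m k : ℝ, ∀ y ∈ Set.Icc c yC, u (xB, y) = m * y + k) ∧
        (∃ m k : ℝ, ∀ x ∈ Set.Icc xA d, u (x, yC) = m * x + k) ∧
        (∃ m k : ℝ, ∀ x ∈ Set.Icc d xB, u (x, yC) = m * x + k) := by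
  obtain ⟨κ₁, hκ₁⟩ := hC3a
  obtain ⟨κ₂, hκ₂⟩ := hC3b
  obtain ⟨F₁, hF₁, hFf₁⟩ := exists_powerDensity h0 h1 hf1 hκ₁
  obtain ⟨F₂, hF₂, hFf₂⟩ := exists_powerDensity h2 h3 hf2 hκ₂
  have hδ : 0 ≤ 3 + κ₁ + κ₂ := by
    have := hC2 xA ⟨le_rfl, h1.le⟩ yA ⟨le_rfl, h3.le⟩
    rw [hκ₁ xA ⟨le_rfl, h1.le⟩, hκ₂ yA ⟨le_rfl, h3.le⟩] at this
    linarith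
  have hrevF : ∀ u, Rev xA xB yA yC f1 f2 u = Rev xA xB yA yC F₁ F₂ u := fun u =>
    rev_congr_s11 hFf₁ hFf₂ fun _ _ => rfl
  have hzero : Feasible xA xB yA yC fun _ => 0 :=
    ⟨fun _ _ => le_rfl, convexOn_const 0 (convex_Icc _ _), fun _ _ _ _ h _ _ => by simpa using h,
      fun _ _ _ _ _ h _ => by simpa using h⟩
  obtain ⟨θ₀, hθ₀, -⟩ := exists_menuUtil_ge hF₁ hF₂ hδ hzero
  obtain ⟨θ, hθ, hmax⟩ := (isCompact_menuParams xA xB yA yC _).exists_isMaxOn ⟨θ₀, hθ₀⟩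
    (continuous_boundaryRev_menuUtil (κ₁ := κ₁) (κ₂ := κ₂) hF₁.cont hF₂.cont).continuousOn
  obtain ⟨⟨⟨hα, hm, hn⟩, ⟨hα', hm', hn'⟩, -⟩, hG, hH⟩ := hθ
  have hGi := unitIncr_maxAffine (a := yA) (b := yC) (α := θ.1.1) (β := θ.2.2) hm hn
  have hHi := unitIncr_maxAffine (a := xA) (b := xB) (α := θ.2.1.1) (β := θ.2.2) hm' hn'
  have hfeas : Feasible xA xB yA yC (menuUtil xA xB yA yC θ) :=
    feasible_edgeUtil hGi hHi (convexOn_maxAffine _ _ _ _ _ _) (convexOn_maxAffine _ _ _ _ _ _)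
  have hgreat : IsGreatest {r | ∃ u, Feasible xA xB yA yC u ∧ r = Rev xA xB yA yC f1 f2 u}
      (Rev xA xB yA yC f1 f2 (menuUtil xA xB yA yC θ)) := by
    refine ⟨⟨_, hfeas, rfl⟩, ?_⟩
    rintro _ ⟨u, hu, rfl⟩
    obtain ⟨η, hη, hle⟩ := exists_menuUtil_ge hF₁ hF₂ hδ hu
    rw [hrevF, hrevF, rev_eq_boundaryRev hF₁ hF₂
      (u := menuUtil xA xB yA yC θ) (unitIncr₂_edgeUtil hGi hHi)]
    exact hle.trans (hmax hη)
  have hcorner : maxAffine xA xB θ.2.1.1 θ.2.1.2.1 θ.2.1.2.2 θ.2.2 xB =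
      maxAffine yA yC θ.1.1 θ.1.2.1 θ.1.2.2 θ.2.2 yC :=
    (maxAffine_right hH).trans (maxAffine_right hG).symm
  obtain ⟨c, hc, ⟨r₁, k₁, e₁⟩, r₂, k₂, e₂⟩ := maxAffine_two_pieces (n := θ.1.2.2) h3 hG
  obtain ⟨d, hd, ⟨r₃, k₃, e₃⟩, r₄, k₄, e₄⟩ := maxAffine_two_pieces (n := θ.2.1.2.2) h1 hH
  have right : ∀ y ∈ Icc yA yC, menuUtil xA xB yA yC θ (xB, y) =
      maxAffine yA yC θ.1.1 θ.1.2.1 θ.1.2.2 θ.2.2 y := fun y hy =>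
    edgeUtil_right hGi hcorner hy.2 (maxAffine_nonneg hα.1 hm hy.1)
  have top : ∀ x ∈ Icc xA xB, menuUtil xA xB yA yC θ (x, yC) =
      maxAffine xA xB θ.2.1.1 θ.2.1.2.1 θ.2.1.2.2 θ.2.2 x := fun x hx =>
    edgeUtil_top hHi hcorner hx.2 (maxAffine_nonneg hα'.1 hm' hx.1)
  exact ⟨menuUtil xA xB yA yC θ, ⟨hfeas, hgreat.csSup_eq.symm⟩, c, hc, d, hd,
    ⟨r₁, k₁, fun y hy => (right y ⟨hy.1, hy.2.trans hc.2⟩).trans (e₁ y hy)⟩,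
    ⟨r₂, k₂, fun y hy => (right y ⟨hc.1.trans hy.1, hy.2⟩).trans (e₂ y hy)⟩,
    ⟨r₃, k₃, fun x hx => (top x ⟨hx.1, hx.2.trans hd.2⟩).trans (e₃ x hx)⟩,
    ⟨r₄, k₄, fun x hx => (top x ⟨hd.1.trans hx.1, hx.2⟩).trans (e₄ x hx)⟩⟩
end
end
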